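/- Let u be a real-valued harmonic function on the open unit ball B_n of R^n with |u| < 1 on B_n, where n = 2 or n ≥ 4. Then for every x in B_n, |∇u(x)| ≤ (2·vol_{n-1}(B_{n-1}) / vol_n(B_n)) · 1/(1 - |x|²), where vol_k denotes k-dimensional Lebesgue measure of the k-dimensional unit ball. -/

import Mathlib

open MeasureTheory Real in
/-- k-dimensional Lebesgue measure of the unit ball in R^k. -/
noncomputable def unitBallVol (k : Nat) : Real :=
  (volume (Metric.ball (0 : EuclideanSpace Real (Fin k)) 1)).toReal

/-- u is harmonic on s: C^2 and the Laplacian vanishes on s. -/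
def IsHarmonicOn {n : Nat} (u : EuclideanSpace Real (Fin n) -> Real)
    (s : Set (EuclideanSpace Real (Fin n))) : Prop :=
  ContDiffOn Real 2 u s /\ ∀ x ∈ s,
    (∑ i : Fin n, fderiv Real (fun y => fderiv Real u y (EuclideanSpace.single i 1)) x
      (EuclideanSpace.single i 1)) = 0


section
open MeasureTheory Filter Topology Set

/-- Pointwise weak harmonicity along an orthonormal basis. -/
def HarmAt {n : ℕ} (b : OrthonormalBasis (Fin n) ℝ (EuclideanSpace ℝ (Fin n)))
    (u : EuclideanSpace ℝ (Fin n) → ℝ) (x : EuclideanSpace ℝ (Fin n)) : Prop :=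
  ∃ d : Fin n → ℝ, (∑ i, d i = 0) ∧ ∀ i, ∃ g : ℝ → ℝ,
    (∀ᶠ t in 𝓝 (0:ℝ), HasDerivAt (fun t : ℝ => u (x + t • b i)) (g t) t) ∧ HasDerivAt g (d i) 0

lemma HarmAt.sub {n : ℕ} {b : OrthonormalBasis (Fin n) ℝ (EuclideanSpace ℝ (Fin n))}
    {u v : EuclideanSpace ℝ (Fin n) → ℝ} {x : EuclideanSpace ℝ (Fin n)}
    (hu : HarmAt b u x) (hv : HarmAt b v x) : HarmAt b (fun y => u y - v y) x := by
  obtain ⟨d, hd, h⟩ := hu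
  obtain ⟨d', hd', h'⟩ := hv
  refine ⟨fun i => d i - d' i, by simp [hd, hd'], fun i => ?_⟩
  obtain ⟨g, hg, hg2⟩ := h i
  obtain ⟨g', hg', hg2'⟩ := h' i
  refine ⟨fun t => g t - g' t, ?_, hg2.sub hg2'⟩
  filter_upwards [hg, hg'] with t h1 h2 using h1.sub h2

lemma HarmAt.congr {n : ℕ} {b : OrthonormalBasis (Fin n) ℝ (EuclideanSpace ℝ (Fin n))}
    {u v : EuclideanSpace ℝ (Fin n) → ℝ} {x : EuclideanSpace ℝ (Fin n)}
    (hu : HarmAt b u x) (huv : ∀ᶠ y in 𝓝 x, u y = v y) : HarmAt b v x := by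
  obtain ⟨d, hd, h⟩ := hu
  refine ⟨d, hd, fun i => ?_⟩
  obtain ⟨g, hg, hg2⟩ := h i
  refine ⟨g, ?_, hg2⟩
  have hc : Tendsto (fun t : ℝ => x + t • b i) (𝓝 0) (𝓝 x) := by
    have : Continuous (fun t : ℝ => x + t • b i) := by fun_prop
    simpa using this.tendsto 0
  have := hc.eventually huv
  filter_upwards [hg, this.eventually_nhds] with t h1 h2
  exact h1.congr_of_eventuallyEq (h2.mono fun s hs => hs.symm)

lemma HarmAt.const {n : ℕ} (b : OrthonormalBasis (Fin n) ℝ (EuclideanSpace ℝ (Fin n)))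
    (c : ℝ) (x : EuclideanSpace ℝ (Fin n)) : HarmAt b (fun _ => c) x :=
  ⟨fun _ => 0, by simp, fun i => ⟨fun _ => 0, Eventually.of_forall fun t => hasDerivAt_const t c,
    hasDerivAt_const _ _⟩⟩

lemma HarmAt.affine {n : ℕ} (b : OrthonormalBasis (Fin n) ℝ (EuclideanSpace ℝ (Fin n)))
    (c : ℝ) (l : EuclideanSpace ℝ (Fin n)) (x : EuclideanSpace ℝ (Fin n)) :
    HarmAt b (fun y => c - inner ℝ y l) x := by
  refine ⟨fun _ => 0, by simp, fun i => ⟨fun _ => - inner ℝ (b i) l, Eventually.of_forall fun t => ?_,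
    hasDerivAt_const _ _⟩⟩
  have : (fun t : ℝ => c - inner ℝ (x + t • b i) l) = fun t => (c - inner ℝ x l) - t * inner ℝ (b i) l := by
    ext t; rw [inner_add_left, inner_smul_left]; simp; ring
  rw [this]
  have := ((hasDerivAt_id t).mul_const (inner ℝ (b i) l)).const_sub (c - inner ℝ x l)
  simpa using this

lemma second_deriv_nonpos {f g : ℝ → ℝ} {d : ℝ} (hmax : IsLocalMax f 0)
    (hf : ∀ᶠ t in 𝓝 (0:ℝ), HasDerivAt f (g t) t) (hg : HasDerivAt g d 0) : d ≤ 0 := by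
  by_contra! hd
  have h0 : g 0 = 0 := hmax.hasDerivAt_eq_zero hf.self_of_nhds
  have hdf : deriv f =ᶠ[𝓝 0] g := hf.mono fun t ht => ht.deriv
  have h1 : deriv (deriv f) 0 = d := by
    rw [hdf.deriv_eq]; exact hg.deriv
  have hmin : IsLocalMin f 0 := isLocalMin_of_deriv_deriv_pos (by rw [h1]; exact hd)
    (by rw [hdf.self_of_nhds, h0]) hf.self_of_nhds.continuousAt
  have hconst : f =ᶠ[𝓝 0] fun _ => f 0 := by
    filter_upwards [hmax, hmin] with t a b using le_antisymm a b
  have h2 : deriv f =ᶠ[𝓝 0] fun _ => 0 := by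
    have := hconst.deriv
    refine this.trans (Eventually.of_forall fun t => by simp)
  have : deriv (deriv f) 0 = 0 := by rw [h2.deriv_eq]; simp
  linarith

/-- Weak maximum principle. -/
theorem max_principle {n : ℕ} (hn : 0 < n)
    (b : OrthonormalBasis (Fin n) ℝ (EuclideanSpace ℝ (Fin n)))
    {K Ω : Set (EuclideanSpace ℝ (Fin n))} (hK : IsCompact K) (hO : IsOpen Ω) (hOK : Ω ⊆ K)
    {Z : EuclideanSpace ℝ (Fin n) → ℝ} (hZ : ContinuousOn Z K)
    (hh : ∀ x ∈ Ω, HarmAt b Z x) (hb : ∀ x ∈ K \ Ω, Z x ≤ 0) : ∀ x ∈ K, Z x ≤ 0 := by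
  intro x0 hx0
  by_contra! hpos
  obtain ⟨R, hR⟩ := hK.isBounded.exists_norm_le
  have hR0 : 0 ≤ R := (norm_nonneg _).trans (hR x0 hx0)
  set ε := Z x0 / (2 * (R^2 + 1)) with hε
  have hε0 : 0 < ε := by positivity
  have hεR : ε * R^2 < Z x0 := by
    rw [hε, div_mul_eq_mul_div, div_lt_iff₀ (by positivity)]
    nlinarith [sq_nonneg R]
  have hcont : ContinuousOn (fun x => Z x + ε * ‖x‖^2) K :=
    hZ.add (by fun_prop)
  obtain ⟨p, hpK, hp⟩ := hK.exists_isMaxOn ⟨x0, hx0⟩ hcont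
  have h1 : Z x0 + ε * ‖x0‖^2 ≤ Z p + ε * ‖p‖^2 := hp hx0
  have hpO : p ∈ Ω := by
    by_contra hpO
    have h2 := hb p ⟨hpK, hpO⟩
    have h3 : ‖p‖^2 ≤ R^2 := pow_le_pow_left₀ (norm_nonneg _) (hR p hpK) 2
    have := mul_le_mul_of_nonneg_left h3 hε0.le
    have := mul_nonneg hε0.le (sq_nonneg ‖x0‖)
    linarith
  obtain ⟨d, hd, h⟩ := hh p hpO
  have key : ∀ i, d i + 2 * ε ≤ 0 := by
    intro i
    obtain ⟨g, hg, hg2⟩ := h i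
    have hq : ∀ t : ℝ, ‖p + t • b i‖^2 = ‖p‖^2 + 2 * inner ℝ p (b i) * t + t^2 := by
      intro t
      rw [norm_add_sq_real, inner_smul_right, norm_smul, b.norm_eq_one]
      simp; ring
    apply second_deriv_nonpos (f := fun t : ℝ => Z (p + t • b i) + ε * ‖p + t • b i‖^2)
      (g := fun t => g t + ε * (2 * inner ℝ p (b i) + 2 * t))
    · have hc : Tendsto (fun t : ℝ => p + t • b i) (𝓝 0) (𝓝 p) := by
        have : Continuous (fun t : ℝ => p + t • b i) := by fun_prop
        simpa using this.tendsto 0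
      filter_upwards [hc.eventually (hO.mem_nhds hpO)] with t ht
      have := hp (hOK ht)
      simpa using this
    · filter_upwards [hg] with t ht
      simp only [hq]
      refine ht.add (HasDerivAt.const_mul ε ?_)
      have h5 : HasDerivAt (fun t : ℝ => ‖p‖^2 + 2 * inner ℝ p (b i) * t + t^2) _ t :=
        (((hasDerivAt_id t).const_mul (2 * inner ℝ p (b i))).const_add (‖p‖^2)).add (hasDerivAt_pow 2 t)
      exact h5.congr_deriv (by simp)
    · refine hg2.add ?_
      have h5 : HasDerivAt (fun t : ℝ => ε * (2 * inner ℝ p (b i) + 2 * t)) _ 0 :=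
        (((hasDerivAt_id (0:ℝ)).const_mul 2).const_add (2 * inner ℝ p (b i))).const_mul ε
      exact h5.congr_deriv (by ring)
  have hs : ∑ i, (d i + 2 * ε) ≤ 0 := Finset.sum_nonpos fun i _ => key i
  rw [Finset.sum_add_distrib, hd] at hs
  simp at hs
  have : (0:ℝ) < n := by exact_mod_cast hn
  nlinarith [mul_pos this hε0]

end

section
open MeasureTheory Filter Topology Set

/-- Normalised rotation invariant measure on the unit sphere. -/
noncomputable def sphMeas (n : ℕ) : Measure (EuclideanSpace ℝ (Fin n)) :=
  ((volume (Metric.ball (0 : EuclideanSpace ℝ (Fin n)) 1))⁻¹ •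
    volume.restrict (Metric.ball (0 : EuclideanSpace ℝ (Fin n)) 1)).map (fun y => ‖y‖⁻¹ • y)

lemma sph_meas_proj (n : ℕ) : Measurable (fun y : EuclideanSpace ℝ (Fin n) => ‖y‖⁻¹ • y) := by
  fun_prop

instance sph_prob (n : ℕ) : IsProbabilityMeasure (sphMeas n) := by
  unfold sphMeas
  refine ⟨?_⟩
  rw [Measure.map_apply (sph_meas_proj n) MeasurableSet.univ]
  simp only [preimage_univ, Measure.smul_apply, Measure.restrict_apply_univ, smul_eq_mul]
  refine ENNReal.inv_mul_cancel ?_ ?_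
  · exact (Metric.measure_ball_pos _ _ one_pos).ne'
  · exact Metric.isBounded_ball.measure_lt_top.ne

lemma sph_ae {n : ℕ} (hn : 0 < n) : ∀ᵐ z ∂(sphMeas n), z ∈ Metric.sphere (0 : EuclideanSpace ℝ (Fin n)) 1 := by
  unfold sphMeas
  refine (ae_map_iff (p := fun z => z ∈ Metric.sphere (0 : EuclideanSpace ℝ (Fin n)) 1)
    (sph_meas_proj n).aemeasurable Metric.isClosed_sphere.measurableSet).2 ?_
  apply Measure.ae_smul_measure
  apply ae_restrict_of_ae
  haveI : Nonempty (Fin n) := ⟨⟨0, hn⟩⟩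
  have : ∀ᵐ y : EuclideanSpace ℝ (Fin n), y ≠ 0 := by
    simp [ae_iff]
  filter_upwards [this] with y hy
  simp [norm_smul, hy]

lemma sph_map {n : ℕ} (L : EuclideanSpace ℝ (Fin n) ≃ₗᵢ[ℝ] EuclideanSpace ℝ (Fin n)) :
    (sphMeas n).map L = sphMeas n := by
  unfold sphMeas
  rw [Measure.map_map L.continuous.measurable (sph_meas_proj n)]
  have h1 : (L ∘ fun y : EuclideanSpace ℝ (Fin n) => ‖y‖⁻¹ • y) = (fun y => ‖y‖⁻¹ • y) ∘ L := by
    ext1 y; simp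
  rw [h1, ← Measure.map_map (sph_meas_proj n) L.continuous.measurable]
  congr 1
  rw [Measure.map_smul]
  congr 1
  have h2 : L ⁻¹' (Metric.ball 0 1) = Metric.ball (0 : EuclideanSpace ℝ (Fin n)) 1 := by
    ext y; simp
  have h3 := (L.measurePreserving.restrict_preimage (s := Metric.ball 0 1) Metric.isOpen_ball.measurableSet).map_eq
  rw [h2] at h3
  exact h3

lemma sph_integral_comp {n : ℕ} (L : EuclideanSpace ℝ (Fin n) ≃ₗᵢ[ℝ] EuclideanSpace ℝ (Fin n))
    (f : EuclideanSpace ℝ (Fin n) → ℝ) : ∫ z, f (L z) ∂(sphMeas n) = ∫ z, f z ∂(sphMeas n) := by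
  conv_rhs => rw [← sph_map L]
  exact (L.toHomeomorph.measurableEmbedding.integral_map f).symm

lemma sph_restrict {n : ℕ} (hn : 0 < n) : (sphMeas n).restrict (Metric.sphere 0 1) = sphMeas n :=
  Measure.restrict_eq_self_of_ae_mem (sph_ae hn)

lemma sph_aesm {n : ℕ} (hn : 0 < n) {f : EuclideanSpace ℝ (Fin n) → ℝ}
    (hf : ContinuousOn f (Metric.sphere 0 1)) : AEStronglyMeasurable f (sphMeas n) := by
  rw [← sph_restrict hn]
  exact hf.aestronglyMeasurable Metric.isClosed_sphere.measurableSet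

lemma sph_integrable {n : ℕ} (hn : 0 < n) {f : EuclideanSpace ℝ (Fin n) → ℝ}
    (hf : ContinuousOn f (Metric.sphere 0 1)) : Integrable f (sphMeas n) := by
  rw [← sph_restrict hn]
  exact hf.integrableOn_compact (isCompact_sphere _ _)

lemma sph_integral_mono {n : ℕ} (hn : 0 < n) {f g : EuclideanSpace ℝ (Fin n) → ℝ}
    (hf : ContinuousOn f (Metric.sphere 0 1)) (hg : ContinuousOn g (Metric.sphere 0 1))
    (h : ∀ z ∈ Metric.sphere (0 : EuclideanSpace ℝ (Fin n)) 1, f z ≤ g z) :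
    ∫ z, f z ∂(sphMeas n) ≤ ∫ z, g z ∂(sphMeas n) :=
  integral_mono_ae (sph_integrable hn hf) (sph_integrable hn hg) ((sph_ae hn).mono h)

lemma sph_integral_congr {n : ℕ} (hn : 0 < n) {f g : EuclideanSpace ℝ (Fin n) → ℝ}
    (h : ∀ z ∈ Metric.sphere (0 : EuclideanSpace ℝ (Fin n)) 1, f z = g z) :
    ∫ z, f z ∂(sphMeas n) = ∫ z, g z ∂(sphMeas n) :=
  integral_congr_ae ((sph_ae hn).mono h)

lemma sph_integral_nonneg {n : ℕ} (hn : 0 < n) {f : EuclideanSpace ℝ (Fin n) → ℝ}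
    (h : ∀ z ∈ Metric.sphere (0 : EuclideanSpace ℝ (Fin n)) 1, 0 ≤ f z) :
    0 ≤ ∫ z, f z ∂(sphMeas n) :=
  integral_nonneg_of_ae ((sph_ae hn).mono h)

/-- Differentiation under the integral over the sphere. -/
lemma sph_hasDerivAt {n : ℕ} (hn : 0 < n) {F F' : ℝ → EuclideanSpace ℝ (Fin n) → ℝ} {t₀ : ℝ} {s : Set ℝ}
    (hs : s ∈ 𝓝 t₀) (hsc : IsCompact s)
    (hF : ∀ t ∈ s, ContinuousOn (F t) (Metric.sphere 0 1))
    (hF' : ContinuousOn (Function.uncurry F') (s ×ˢ Metric.sphere 0 1))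
    (hd : ∀ t ∈ s, ∀ z ∈ Metric.sphere (0 : EuclideanSpace ℝ (Fin n)) 1,
      HasDerivAt (fun t => F t z) (F' t z) t) :
    HasDerivAt (fun t => ∫ z, F t z ∂(sphMeas n)) (∫ z, F' t₀ z ∂(sphMeas n)) t₀ := by
  obtain ⟨C, hC⟩ := (hsc.prod (isCompact_sphere (0 : EuclideanSpace ℝ (Fin n)) 1)).exists_bound_of_continuousOn hF'
  have ht₀ : t₀ ∈ s := mem_of_mem_nhds hs
  refine (hasDerivAt_integral_of_dominated_loc_of_deriv_le (bound := fun _ => C) hs ?_ ?_ ?_ ?_ ?_ ?_).2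
  · filter_upwards [hs] with t ht using sph_aesm hn (hF t ht)
  · exact sph_integrable hn (hF t₀ ht₀)
  · refine sph_aesm hn ?_
    exact hF'.comp (f := fun z => (t₀, z)) (by fun_prop) (fun z hz => ⟨ht₀, hz⟩)
  · filter_upwards [sph_ae hn] with z hz t ht
    exact hC (t, z) ⟨ht, hz⟩
  · exact integrable_const _
  · filter_upwards [sph_ae hn] with z hz t ht
    exact hd t ht z hz

/-- Rotation taking a unit vector to another. -/
lemma exists_isometry {n : ℕ} {x y : EuclideanSpace ℝ (Fin n)} (h : ‖x‖ = ‖y‖) :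
    ∃ L : EuclideanSpace ℝ (Fin n) ≃ₗᵢ[ℝ] EuclideanSpace ℝ (Fin n), L x = y ∧ L y = x := by
  refine ⟨(ℝ ∙ (x - y))ᗮ.reflection, ?_, ?_⟩
  · exact Submodule.reflection_sub h
  · have := Submodule.reflection_sub h
    have h2 := congrArg (ℝ ∙ (x - y))ᗮ.reflection this
    rw [Submodule.reflection_reflection] at h2
    exact h2.symm

end

section
open MeasureTheory Filter Topology Set

/-- Common form of the Poisson kernel and the Newton kernel. -/
noncomputable def genKer {n : ℕ} (A B m : ℝ) (x z : EuclideanSpace ℝ (Fin n)) : ℝ :=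
  (A - B * ‖x‖^2) * (‖x - z‖^2) ^ (-m)

noncomputable def genKer1 {n : ℕ} (A B m : ℝ) (b x z : EuclideanSpace ℝ (Fin n)) : ℝ :=
  (-2 * B * inner ℝ x b) * (‖x - z‖^2) ^ (-m)
    - m * (A - B * ‖x‖^2) * (2 * inner ℝ (x - z) b) * (‖x - z‖^2) ^ (-m-1)

noncomputable def genKer2 {n : ℕ} (A B m : ℝ) (b x z : EuclideanSpace ℝ (Fin n)) : ℝ :=
  (-2 * B) * (‖x - z‖^2) ^ (-m)
    - 2 * m * (-2 * B * inner ℝ x b) * (2 * inner ℝ (x - z) b) * (‖x - z‖^2) ^ (-m-1)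
    - 2 * m * (A - B * ‖x‖^2) * (‖x - z‖^2) ^ (-m-1)
    + m * (m + 1) * (A - B * ‖x‖^2) * (2 * inner ℝ (x - z) b)^2 * (‖x - z‖^2) ^ (-m-2)

section
variable {n : ℕ}

lemma hd_line (x b : EuclideanSpace ℝ (Fin n)) (t : ℝ) : HasDerivAt (fun t : ℝ => x + t • b) b t := by
  simpa using ((hasDerivAt_id t).smul_const b).const_add x

lemma hd_pow (x z b : EuclideanSpace ℝ (Fin n)) (m t : ℝ) (h : x + t • b ≠ z) :
    HasDerivAt (fun t : ℝ => (‖x + t • b - z‖^2) ^ m)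
      (m * (2 * inner ℝ (x + t • b - z) b) * (‖x + t • b - z‖^2) ^ (m - 1)) t := by
  have h1 := ((hd_line x b t).sub_const z).norm_sq
  have h2 : ‖x + t • b - z‖^2 ≠ 0 := by
    have : x + t • b - z ≠ 0 := sub_ne_zero.2 h
    positivity
  refine (h1.rpow_const (p := m) (Or.inl h2)).congr_deriv ?_
  ring

lemma genKer_hd (A B m : ℝ) (x z b : EuclideanSpace ℝ (Fin n)) (t : ℝ) (h : x + t • b ≠ z) :
    HasDerivAt (fun t : ℝ => genKer A B m (x + t • b) z) (genKer1 A B m b (x + t • b) z) t := by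
  unfold genKer genKer1
  have h1 := (((hd_line x b t).norm_sq).const_mul B).const_sub A
  refine (h1.mul (hd_pow x z b (-m) t h)).congr_deriv ?_
  ring

lemma genKer1_hd (A B m : ℝ) (x z b : EuclideanSpace ℝ (Fin n)) (hb : ‖b‖ = 1) (t : ℝ) (h : x + t • b ≠ z) :
    HasDerivAt (fun t : ℝ => genKer1 A B m b (x + t • b) z) (genKer2 A B m b (x + t • b) z) t := by
  unfold genKer1 genKer2
  have hbb : inner ℝ b b = (1:ℝ) := by rw [real_inner_self_eq_norm_sq, hb]; norm_num
  have h1 := (((hd_line x b t).norm_sq).const_mul B).const_sub A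
  have h2 : HasDerivAt (fun t : ℝ => inner ℝ (x + t • b) b) 1 t :=
    ((hd_line x b t).inner ℝ (hasDerivAt_const t b)).congr_deriv (by simp [hb])
  have h3 : HasDerivAt (fun t : ℝ => inner ℝ (x + t • b - z) b) 1 t :=
    (((hd_line x b t).sub_const z).inner ℝ (hasDerivAt_const t b)).congr_deriv (by simp [hb])
  have h4 := ((h2.const_mul (-2 * B)).mul (hd_pow x z b (-m) t h)).sub
    (((h1.const_mul m).mul (h3.const_mul 2)).mul (hd_pow x z b (-m-1) t h))
  refine h4.congr_deriv ?_
  simp only [Pi.mul_apply]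
  rw [show -m - 1 - 1 = -m - 2 by ring]
  ring

lemma cont_aux {X : Type*} [TopologicalSpace X] {s : Set X} {p q : X → EuclideanSpace ℝ (Fin n)} (m : ℝ)
    (hp : ContinuousOn p s) (hq : ContinuousOn q s) (h : ∀ x ∈ s, p x ≠ q x) :
    ContinuousOn (fun x => (‖p x - q x‖^2) ^ m) s := by
  refine ContinuousOn.rpow_const ((hp.sub hq).norm.pow 2) fun x hx => Or.inl ?_
  have : p x - q x ≠ 0 := sub_ne_zero.2 (h x hx)
  positivity

lemma genKer_cont {X : Type*} [TopologicalSpace X] {s : Set X} {p q : X → EuclideanSpace ℝ (Fin n)} (A B m : ℝ)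
    (hp : ContinuousOn p s) (hq : ContinuousOn q s) (h : ∀ x ∈ s, p x ≠ q x) :
    ContinuousOn (fun x => genKer A B m (p x) (q x)) s := by
  unfold genKer
  have := cont_aux (-m) hp hq h
  fun_prop

lemma genKer1_cont {X : Type*} [TopologicalSpace X] {s : Set X} {p q : X → EuclideanSpace ℝ (Fin n)} (A B m : ℝ)
    (b : EuclideanSpace ℝ (Fin n))
    (hp : ContinuousOn p s) (hq : ContinuousOn q s) (h : ∀ x ∈ s, p x ≠ q x) :
    ContinuousOn (fun x => genKer1 A B m b (p x) (q x)) s := by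
  unfold genKer1
  have := cont_aux (-m) hp hq h
  have := cont_aux (-m-1) hp hq h
  fun_prop

lemma genKer2_cont {X : Type*} [TopologicalSpace X] {s : Set X} {p q : X → EuclideanSpace ℝ (Fin n)} (A B m : ℝ)
    (b : EuclideanSpace ℝ (Fin n))
    (hp : ContinuousOn p s) (hq : ContinuousOn q s) (h : ∀ x ∈ s, p x ≠ q x) :
    ContinuousOn (fun x => genKer2 A B m b (p x) (q x)) s := by
  unfold genKer2
  have := cont_aux (-m) hp hq h
  have := cont_aux (-m-1) hp hq h
  have := cont_aux (-m-2) hp hq h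
  fun_prop

lemma line_ne {x z b : EuclideanSpace ℝ (Fin n)} (hx : ‖x‖ < 1) (hb : ‖b‖ = 1) (hz : ‖z‖ = 1) {t : ℝ}
    (ht : t ∈ Icc (-((1-‖x‖)/2)) ((1-‖x‖)/2)) : x + t • b ≠ z := by
  intro h
  have h1 : ‖x + t • b‖ ≤ ‖x‖ + |t| := by
    refine (norm_add_le _ _).trans ?_
    rw [norm_smul, hb, Real.norm_eq_abs, mul_one]
  rw [h, hz] at h1
  have := abs_le.2 ht
  linarith

/-- First derivative of kernel integrals. -/
lemma ker_hd (hn : 0 < n) (A B m : ℝ) {x b : EuclideanSpace ℝ (Fin n)} (hx : ‖x‖ < 1) (hb : ‖b‖ = 1)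
    {f : EuclideanSpace ℝ (Fin n) → ℝ} (hf : ContinuousOn f (Metric.sphere 0 1))
    {ψ : EuclideanSpace ℝ (Fin n) → EuclideanSpace ℝ (Fin n)} (hψ : ContinuousOn ψ (Metric.sphere 0 1))
    (hψ1 : ∀ z ∈ Metric.sphere (0 : EuclideanSpace ℝ (Fin n)) 1, ‖ψ z‖ = 1) {t : ℝ}
    (ht : t ∈ Ioo (-((1-‖x‖)/2)) ((1-‖x‖)/2)) :
    HasDerivAt (fun t : ℝ => ∫ z, genKer A B m (x + t • b) (ψ z) * f z ∂(sphMeas n))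
      (∫ z, genKer1 A B m b (x + t • b) (ψ z) * f z ∂(sphMeas n)) t := by
  refine sph_hasDerivAt hn (F' := fun t z => genKer1 A B m b (x + t • b) (ψ z) * f z)
    (s := Icc (-((1-‖x‖)/2)) ((1-‖x‖)/2)) (Icc_mem_nhds ht.1 ht.2) isCompact_Icc ?_ ?_ ?_
  · intro t ht
    exact (genKer_cont A B m continuousOn_const hψ fun z hz => line_ne hx hb (hψ1 z hz) ht).mul hf
  · refine ContinuousOn.mul (genKer1_cont A B m b (p := fun w : ℝ × EuclideanSpace ℝ (Fin n) => x + w.1 • b)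
      (q := fun w => ψ w.2) (by fun_prop) ?_ ?_) ?_
    · exact hψ.comp continuousOn_snd fun w hw => hw.2
    · intro w hw
      exact line_ne hx hb (hψ1 _ hw.2) hw.1
    · exact hf.comp continuousOn_snd fun w hw => hw.2
  · intro t ht z hz
    exact (genKer_hd A B m x (ψ z) b t (line_ne hx hb (hψ1 z hz) ht)).mul_const (f z)

lemma ker1_hd (hn : 0 < n) (A B m : ℝ) {x b : EuclideanSpace ℝ (Fin n)} (hx : ‖x‖ < 1) (hb : ‖b‖ = 1)
    {f : EuclideanSpace ℝ (Fin n) → ℝ} (hf : ContinuousOn f (Metric.sphere 0 1))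
    {ψ : EuclideanSpace ℝ (Fin n) → EuclideanSpace ℝ (Fin n)} (hψ : ContinuousOn ψ (Metric.sphere 0 1))
    (hψ1 : ∀ z ∈ Metric.sphere (0 : EuclideanSpace ℝ (Fin n)) 1, ‖ψ z‖ = 1) {t : ℝ}
    (ht : t ∈ Ioo (-((1-‖x‖)/2)) ((1-‖x‖)/2)) :
    HasDerivAt (fun t : ℝ => ∫ z, genKer1 A B m b (x + t • b) (ψ z) * f z ∂(sphMeas n))
      (∫ z, genKer2 A B m b (x + t • b) (ψ z) * f z ∂(sphMeas n)) t := by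
  refine sph_hasDerivAt hn (F' := fun t z => genKer2 A B m b (x + t • b) (ψ z) * f z)
    (s := Icc (-((1-‖x‖)/2)) ((1-‖x‖)/2)) (Icc_mem_nhds ht.1 ht.2) isCompact_Icc ?_ ?_ ?_
  · intro t ht
    exact (genKer1_cont A B m b continuousOn_const hψ fun z hz => line_ne hx hb (hψ1 z hz) ht).mul hf
  · refine ContinuousOn.mul (genKer2_cont A B m b (p := fun w : ℝ × EuclideanSpace ℝ (Fin n) => x + w.1 • b)
      (q := fun w => ψ w.2) (by fun_prop) ?_ ?_) ?_
    · exact hψ.comp continuousOn_snd fun w hw => hw.2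
    · intro w hw
      exact line_ne hx hb (hψ1 _ hw.2) hw.1
    · exact hf.comp continuousOn_snd fun w hw => hw.2
  · intro t ht z hz
    exact (genKer1_hd A B m x (ψ z) b hb t (line_ne hx hb (hψ1 z hz) ht)).mul_const (f z)

lemma ker_harm (hn : 0 < n) (A B m : ℝ) (b : OrthonormalBasis (Fin n) ℝ (EuclideanSpace ℝ (Fin n)))
    {x : EuclideanSpace ℝ (Fin n)} (hx : ‖x‖ < 1)
    {f : EuclideanSpace ℝ (Fin n) → ℝ} (hf : ContinuousOn f (Metric.sphere 0 1))
    {ψ : EuclideanSpace ℝ (Fin n) → EuclideanSpace ℝ (Fin n)} (hψ : ContinuousOn ψ (Metric.sphere 0 1))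
    (hψ1 : ∀ z ∈ Metric.sphere (0 : EuclideanSpace ℝ (Fin n)) 1, ‖ψ z‖ = 1)
    (h0 : ∀ z : EuclideanSpace ℝ (Fin n), ‖z‖ = 1 → ∑ i, genKer2 A B m (b i) x z = 0) :
    HarmAt b (fun x => ∫ z, genKer A B m x (ψ z) * f z ∂(sphMeas n)) x := by
  have hI : Ioo (-((1-‖x‖)/2)) ((1-‖x‖)/2) ∈ 𝓝 (0:ℝ) := Ioo_mem_nhds (by linarith) (by linarith)
  refine ⟨fun i => ∫ z, genKer2 A B m (b i) x (ψ z) * f z ∂(sphMeas n), ?_, fun i =>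
    ⟨fun t => ∫ z, genKer1 A B m (b i) (x + t • b i) (ψ z) * f z ∂(sphMeas n), ?_, ?_⟩⟩
  · rw [← integral_finsetSum]
    · have : ∀ z ∈ Metric.sphere (0 : EuclideanSpace ℝ (Fin n)) 1,
          ∑ i, genKer2 A B m (b i) x (ψ z) * f z = 0 := by
        intro z hz
        rw [← Finset.sum_mul, h0 _ (hψ1 z hz), zero_mul]
      rw [sph_integral_congr hn this]; simp
    · intro i _
      refine sph_integrable hn ((genKer2_cont A B m (b i) continuousOn_const hψ fun z hz h => ?_).mul hf)
      have := hψ1 z hz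
      rw [← h] at this
      linarith
  · filter_upwards [hI] with t ht
    exact ker_hd hn A B m hx (b.norm_eq_one i) hf hψ hψ1 ht
  · have := ker1_hd hn A B m hx (b.norm_eq_one i) hf hψ hψ1 (mem_of_mem_nhds hI)
    simpa using this

lemma poisson_lap (hn : 0 < n) (b : OrthonormalBasis (Fin n) ℝ (EuclideanSpace ℝ (Fin n)))
    {x : EuclideanSpace ℝ (Fin n)} (hx : ‖x‖ < 1) (z : EuclideanSpace ℝ (Fin n)) (hz : ‖z‖ = 1) :
    ∑ i, genKer2 1 1 (n/2 : ℝ) (b i) x z = 0 := by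
  have hxz : 0 < ‖x - z‖^2 := by
    have : x - z ≠ 0 := by
      intro h
      rw [sub_eq_zero.1 h] at hx
      linarith
    positivity
  have e1 : ∑ i, inner ℝ x (b i) * inner ℝ (x - z) (b i) = inner ℝ x (x - z) := by
    rw [← b.sum_inner_mul_inner x (x - z)]
    exact Finset.sum_congr rfl fun i _ => by rw [real_inner_comm (b i) (x - z)]
  have e2 : ∑ i, (inner ℝ (x - z) (b i))^2 = ‖x - z‖^2 := by
    rw [← real_inner_self_eq_norm_sq, ← b.sum_inner_mul_inner]
    exact Finset.sum_congr rfl fun i _ => by rw [real_inner_comm (b i) (x - z), sq]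
  have p1 : (‖x - z‖^2) ^ (-(n/2:ℝ)) = ‖x - z‖^2 * (‖x - z‖^2) ^ (-(n/2:ℝ)-1) := by
    rw [Real.rpow_sub_one hxz.ne', mul_div_cancel₀ _ hxz.ne']
  have p2 : (‖x - z‖^2) ^ (-(n/2:ℝ)-2) * ‖x - z‖^2 = (‖x - z‖^2) ^ (-(n/2:ℝ)-1) := by
    rw [show -(n/2:ℝ)-2 = -(n/2:ℝ)-1-1 by ring, Real.rpow_sub_one hxz.ne' (-(n/2:ℝ)-1), div_mul_cancel₀ _ hxz.ne']
  unfold genKer2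
  have : ∀ i, (-2 * (1:ℝ)) * (‖x - z‖^2) ^ (-(n/2:ℝ))
    - 2 * (n/2:ℝ) * (-2 * 1 * inner ℝ x (b i)) * (2 * inner ℝ (x - z) (b i)) * (‖x - z‖^2) ^ (-(n/2:ℝ)-1)
    - 2 * (n/2:ℝ) * (1 - 1 * ‖x‖^2) * (‖x - z‖^2) ^ (-(n/2:ℝ)-1)
    + (n/2:ℝ) * ((n/2:ℝ) + 1) * (1 - 1 * ‖x‖^2) * (2 * inner ℝ (x - z) (b i))^2 * (‖x - z‖^2) ^ (-(n/2:ℝ)-2)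
    = (-2 * ‖x-z‖^2 * (‖x - z‖^2) ^ (-(n/2:ℝ)-1) - n * (1 - ‖x‖^2) * (‖x - z‖^2) ^ (-(n/2:ℝ)-1))
      + 4 * n * (‖x - z‖^2) ^ (-(n/2:ℝ)-1) * (inner ℝ x (b i) * inner ℝ (x - z) (b i))
      + n * (n + 2) * (1 - ‖x‖^2) * (‖x - z‖^2) ^ (-(n/2:ℝ)-2) * (inner ℝ (x - z) (b i))^2 := by
    intro i; rw [p1]; ring
  rw [Finset.sum_congr rfl fun i _ => this i, Finset.sum_add_distrib, Finset.sum_add_distrib,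
    ← Finset.mul_sum, ← Finset.mul_sum, e1, e2]
  simp only [Finset.sum_const, Finset.card_univ, Fintype.card_fin, nsmul_eq_mul]
  rw [mul_assoc _ _ (‖x - z‖^2), p2, norm_sub_sq_real, inner_sub_right,
    real_inner_self_eq_norm_sq, hz]
  ring

lemma newton_lap (b : OrthonormalBasis (Fin n) ℝ (EuclideanSpace ℝ (Fin n)))
    {x : EuclideanSpace ℝ (Fin n)} (hx : ‖x‖ < 1) (z : EuclideanSpace ℝ (Fin n)) (hz : ‖z‖ = 1) :
    ∑ i, genKer2 1 0 ((n-2)/2 : ℝ) (b i) x z = 0 := by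
  have hxz : 0 < ‖x - z‖^2 := by
    have : x - z ≠ 0 := by
      intro h
      rw [sub_eq_zero.1 h] at hx
      linarith
    positivity
  have e2 : ∑ i, (inner ℝ (x - z) (b i))^2 = ‖x - z‖^2 := by
    rw [← real_inner_self_eq_norm_sq, ← b.sum_inner_mul_inner]
    exact Finset.sum_congr rfl fun i _ => by rw [real_inner_comm (b i) (x - z), sq]
  unfold genKer2
  set m : ℝ := (n-2)/2 with hm
  have p2 : (‖x - z‖^2) ^ (-m-2) * ‖x - z‖^2 = (‖x - z‖^2) ^ (-m-1) := by
    rw [show -m-2 = -m-1-1 by ring, Real.rpow_sub_one hxz.ne' (-m-1), div_mul_cancel₀ _ hxz.ne']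
  have : ∀ i, (-2 * (0:ℝ)) * (‖x - z‖^2) ^ (-m)
    - 2 * m * (-2 * 0 * inner ℝ x (b i)) * (2 * inner ℝ (x - z) (b i)) * (‖x - z‖^2) ^ (-m-1)
    - 2 * m * (1 - 0 * ‖x‖^2) * (‖x - z‖^2) ^ (-m-1)
    + m * (m + 1) * (1 - 0 * ‖x‖^2) * (2 * inner ℝ (x - z) (b i))^2 * (‖x - z‖^2) ^ (-m-2)
    = - 2 * m * (‖x - z‖^2) ^ (-m-1)
      + 4 * m * (m + 1) * (‖x - z‖^2) ^ (-m-2) * (inner ℝ (x - z) (b i))^2 := by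
    intro i; ring
  rw [Finset.sum_congr rfl fun i _ => this i, Finset.sum_add_distrib]
  simp only [Finset.sum_const, Finset.card_univ, Fintype.card_fin, nsmul_eq_mul]
  rw [← Finset.mul_sum, e2]
  rw [mul_assoc _ _ (‖x - z‖^2), p2, hm]
  ring
end

end

section
open MeasureTheory Filter Topology Set

section
variable {n : ℕ}

lemma sph_integral_add (hn : 0 < n) {f g : EuclideanSpace ℝ (Fin n) → ℝ}
    (hf : ContinuousOn f (Metric.sphere 0 1)) (hg : ContinuousOn g (Metric.sphere 0 1)) :
    ∫ z, (f z + g z) ∂(sphMeas n) = (∫ z, f z ∂(sphMeas n)) + ∫ z, g z ∂(sphMeas n) :=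
  integral_add (sph_integrable hn hf) (sph_integrable hn hg)

lemma sph_integral_sub (hn : 0 < n) {f g : EuclideanSpace ℝ (Fin n) → ℝ}
    (hf : ContinuousOn f (Metric.sphere 0 1)) (hg : ContinuousOn g (Metric.sphere 0 1)) :
    ∫ z, (f z - g z) ∂(sphMeas n) = (∫ z, f z ∂(sphMeas n)) - ∫ z, g z ∂(sphMeas n) :=
  integral_sub (sph_integrable hn hf) (sph_integrable hn hg)

lemma genKer_comp (A B m : ℝ) (L : EuclideanSpace ℝ (Fin n) ≃ₗᵢ[ℝ] EuclideanSpace ℝ (Fin n))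
    (x z : EuclideanSpace ℝ (Fin n)) : genKer A B m (L x) (L z) = genKer A B m x z := by
  unfold genKer
  rw [← map_sub, L.norm_map, L.norm_map]

lemma ne_of_ball {x z : EuclideanSpace ℝ (Fin n)} (hx : ‖x‖ < 1) (hz : ‖z‖ = 1) : x ≠ z := by
  rintro rfl; linarith

lemma genKer_contz (A B m : ℝ) {x : EuclideanSpace ℝ (Fin n)} (hx : ‖x‖ < 1) :
    ContinuousOn (fun z => genKer A B m x z) (Metric.sphere 0 1) :=
  genKer_cont A B m continuousOn_const continuousOn_id fun z hz => ne_of_ball hx (by simpa using hz)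

/-- Continuity under the integral sign. -/
lemma sph_contAt (hn : 0 < n) {F : EuclideanSpace ℝ (Fin n) → EuclideanSpace ℝ (Fin n) → ℝ}
    {x : EuclideanSpace ℝ (Fin n)} {s : Set (EuclideanSpace ℝ (Fin n))}
    (hs : s ∈ 𝓝 x) (hsc : IsCompact s)
    (hF : ContinuousOn (Function.uncurry F) (s ×ˢ Metric.sphere 0 1)) :
    ContinuousAt (fun t => ∫ z, F t z ∂(sphMeas n)) x := by
  obtain ⟨C, hC⟩ := (hsc.prod (isCompact_sphere (0 : EuclideanSpace ℝ (Fin n)) 1)).exists_bound_of_continuousOn hF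
  refine continuousAt_of_dominated (bound := fun _ => C) ?_ ?_ (integrable_const _) ?_
  · filter_upwards [hs] with t ht
    exact sph_aesm hn (hF.comp (f := fun z => (t, z)) (by fun_prop) (fun z hz => ⟨ht, hz⟩))
  · filter_upwards [hs] with t ht
    filter_upwards [sph_ae hn] with z hz
    exact hC (t, z) ⟨ht, hz⟩
  · filter_upwards [sph_ae hn] with z hz
    have : ContinuousOn (fun t => F t z) s :=
      hF.comp (f := fun t => (t, z)) (by fun_prop) (fun t ht => ⟨ht, hz⟩)
    exact this.continuousAt hs

lemma ker_int_cont (hn : 0 < n) (A B m : ℝ) {x : EuclideanSpace ℝ (Fin n)} (hx : ‖x‖ < 1)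
    {f : EuclideanSpace ℝ (Fin n) → ℝ} (hf : ContinuousOn f (Metric.sphere 0 1))
    {ψ : EuclideanSpace ℝ (Fin n) → EuclideanSpace ℝ (Fin n)} (hψ : ContinuousOn ψ (Metric.sphere 0 1))
    (hψ1 : ∀ z ∈ Metric.sphere (0 : EuclideanSpace ℝ (Fin n)) 1, ‖ψ z‖ = 1) :
    ContinuousAt (fun x => ∫ z, genKer A B m x (ψ z) * f z ∂(sphMeas n)) x := by
  obtain ⟨r, hr, hr1⟩ := exists_between hx
  refine sph_contAt hn (F := fun x z => genKer A B m x (ψ z) * f z) (s := Metric.closedBall 0 r) ?_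
    (isCompact_closedBall _ _) ?_
  · refine mem_of_superset (Metric.isOpen_ball.mem_nhds (x := x) ?_) Metric.ball_subset_closedBall
    simpa using hr
  · refine ContinuousOn.mul (genKer_cont A B m
      (p := fun w : EuclideanSpace ℝ (Fin n) × EuclideanSpace ℝ (Fin n) => w.1)
      (q := fun w => ψ w.2) (by fun_prop) ?_ ?_) ?_
    · exact hψ.comp continuousOn_snd fun w hw => hw.2
    · intro w hw
      have := hw.1
      simp only [Metric.mem_closedBall, dist_zero_right] at this
      exact ne_of_ball (by linarith) (hψ1 _ hw.2)
    · exact hf.comp continuousOn_snd fun w hw => hw.2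

lemma ker_mean (hn : 0 < n) (A B m : ℝ) (b : OrthonormalBasis (Fin n) ℝ (EuclideanSpace ℝ (Fin n)))
    (h0 : ∀ x z : EuclideanSpace ℝ (Fin n), ‖x‖ < 1 → ‖z‖ = 1 → ∑ i, genKer2 A B m (b i) x z = 0)
    {x : EuclideanSpace ℝ (Fin n)} (hx : ‖x‖ < 1) :
    ∫ z, genKer A B m x z ∂(sphMeas n) = A := by
  set I : EuclideanSpace ℝ (Fin n) → ℝ := fun x => ∫ z, genKer A B m x z * 1 ∂(sphMeas n) with hI
  have hrad : ∀ x y, ‖x‖ = ‖y‖ → I x = I y := by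
    intro x y hxy
    obtain ⟨L, hL, -⟩ := exists_isometry hxy
    rw [hI]; dsimp only
    rw [← hL, ← sph_integral_comp L (fun z => genKer A B m (L x) z * 1)]
    simp_rw [genKer_comp]
  have hharm : ∀ x, ‖x‖ < 1 → HarmAt b I x := fun x hx =>
    ker_harm hn A B m b hx (f := fun _ => 1) continuousOn_const (ψ := fun z => z) continuousOn_id
      (fun z hz => by simpa using hz) (fun z hz => h0 x z hx hz)
  have hcont : ContinuousOn I (Metric.closedBall 0 ‖x‖) := by
    intro y hy
    have hy : ‖y‖ < 1 := lt_of_le_of_lt (by simpa using hy) hx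
    exact (ker_int_cont hn A B m hy (f := fun _ => 1) continuousOn_const (ψ := fun z => z) continuousOn_id
      (fun z hz => by simpa using hz)).continuousWithinAt
  have hball : ∀ y ∈ Metric.ball (0 : EuclideanSpace ℝ (Fin n)) ‖x‖, ‖y‖ < 1 := fun y hy =>
    lt_trans (by simpa using hy) hx
  have hbd : ∀ y ∈ Metric.closedBall (0 : EuclideanSpace ℝ (Fin n)) ‖x‖ \ Metric.ball 0 ‖x‖, I y = I x := by
    intro y hy
    apply hrad
    simp only [Set.mem_sdiff, Metric.mem_closedBall, dist_zero_right, Metric.mem_ball, not_lt] at hy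
    linarith
  have h1 := max_principle hn b (isCompact_closedBall 0 ‖x‖) Metric.isOpen_ball Metric.ball_subset_closedBall
    (Z := fun y => I y - I x) (hcont.sub continuousOn_const)
    (fun y hy => (hharm y (hball y hy)).sub (HarmAt.const b _ y)) (fun y hy => by rw [hbd y hy]; simp) 0 (by simp)
  have h2 := max_principle hn b (isCompact_closedBall 0 ‖x‖) Metric.isOpen_ball Metric.ball_subset_closedBall
    (Z := fun y => I x - I y) (continuousOn_const.sub hcont)
    (fun y hy => (HarmAt.const b _ y).sub (hharm y (hball y hy))) (fun y hy => by rw [hbd y hy]; simp) 0 (by simp)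
  have h3 : I 0 = A := by
    rw [hI]; dsimp only
    rw [sph_integral_congr hn (g := fun _ => A)]
    · simp
    · intro z hz
      have hz : ‖z‖ = 1 := by simpa using hz
      simp [genKer, hz]
  have h4 : ∫ z, genKer A B m x z ∂(sphMeas n) = I x := by rw [hI]; simp
  rw [h4, ← h3]; linarith

/-- Poisson kernel. -/
noncomputable def poi (x z : EuclideanSpace ℝ (Fin n)) : ℝ := genKer 1 1 (n/2 : ℝ) x z
/-- Newton kernel. -/
noncomputable def newt (x z : EuclideanSpace ℝ (Fin n)) : ℝ := genKer 1 0 ((n-2)/2 : ℝ) x z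

lemma poi_mean (hn : 0 < n) {x : EuclideanSpace ℝ (Fin n)} (hx : ‖x‖ < 1) :
    ∫ z, poi x z ∂(sphMeas n) = 1 :=
  ker_mean hn 1 1 _ (EuclideanSpace.basisFun (Fin n) ℝ) (fun x z hx hz => poisson_lap hn _ hx z hz) hx

lemma newt_mean (hn : 0 < n) {x : EuclideanSpace ℝ (Fin n)} (hx : ‖x‖ < 1) :
    ∫ z, newt x z ∂(sphMeas n) = 1 :=
  ker_mean hn 1 0 _ (EuclideanSpace.basisFun (Fin n) ℝ) (fun x z hx hz => newton_lap _ hx z hz) hx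

lemma poi_nonneg {x : EuclideanSpace ℝ (Fin n)} (hx : ‖x‖ < 1) (z : EuclideanSpace ℝ (Fin n)) : 0 ≤ poi x z := by
  unfold poi genKer
  have := norm_nonneg x
  have : 0 ≤ 1 - 1 * ‖x‖^2 := by nlinarith
  positivity

lemma newt_nonneg (x z : EuclideanSpace ℝ (Fin n)) : 0 ≤ newt x z := by
  unfold newt genKer
  rw [zero_mul, sub_zero]
  positivity

lemma poi_cont {x : EuclideanSpace ℝ (Fin n)} (hx : ‖x‖ < 1) :
    ContinuousOn (fun z => poi x z) (Metric.sphere 0 1) := genKer_contz _ _ _ hx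
lemma newt_cont {x : EuclideanSpace ℝ (Fin n)} (hx : ‖x‖ < 1) :
    ContinuousOn (fun z => newt x z) (Metric.sphere 0 1) := genKer_contz _ _ _ hx

lemma poi_newt {x z : EuclideanSpace ℝ (Fin n)} (h : x ≠ z) :
    poi x z * ‖x - z‖^2 = (1 - ‖x‖^2) * newt x z := by
  have hxz : 0 < ‖x - z‖^2 := by
    have : x - z ≠ 0 := sub_ne_zero.2 h
    positivity
  unfold poi newt genKer
  have : (‖x - z‖^2) ^ (-((n-2)/2 : ℝ)) = (‖x - z‖^2) ^ (-(n/2 : ℝ)) * ‖x - z‖^2 := by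
    rw [← Real.rpow_add_one hxz.ne']; congr 1; ring
  rw [this]; ring

/-- Poisson integral extended by the boundary values. -/
noncomputable def wc (f : EuclideanSpace ℝ (Fin n) → ℝ) (x : EuclideanSpace ℝ (Fin n)) : ℝ :=
  open Classical in if ‖x‖ < 1 then ∫ z, poi x z * f z ∂(sphMeas n) else f x

lemma wc_in (f : EuclideanSpace ℝ (Fin n) → ℝ) {x : EuclideanSpace ℝ (Fin n)} (hx : ‖x‖ < 1) :
    wc f x = ∫ z, poi x z * f z ∂(sphMeas n) := by simp [wc, hx]
lemma wc_bd (f : EuclideanSpace ℝ (Fin n) → ℝ) {x : EuclideanSpace ℝ (Fin n)} (hx : ‖x‖ = 1) :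
    wc f x = f x := by simp [wc, hx]

lemma wc_harm (hn : 0 < n) (b : OrthonormalBasis (Fin n) ℝ (EuclideanSpace ℝ (Fin n)))
    {f : EuclideanSpace ℝ (Fin n) → ℝ} (hf : ContinuousOn f (Metric.sphere 0 1))
    {x : EuclideanSpace ℝ (Fin n)} (hx : ‖x‖ < 1) : HarmAt b (wc f) x := by
  have h1 := ker_harm hn 1 1 (n/2 : ℝ) b hx hf (ψ := fun z => z) continuousOn_id
      (fun z hz => by simpa using hz) (fun z hz => poisson_lap hn b hx z hz)
  refine h1.congr ?_
  filter_upwards [Metric.isOpen_ball.mem_nhds (show x ∈ Metric.ball 0 1 by simpa using hx)] with y hy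
  rw [wc_in f (by simpa using hy)]; rfl

lemma wc_est (hn : 0 < n) {f : EuclideanSpace ℝ (Fin n) → ℝ} (hf : ContinuousOn f (Metric.sphere 0 1))
    {p : EuclideanSpace ℝ (Fin n)} {ε C : ℝ} (hε : 0 ≤ ε) (hC : 0 ≤ C)
    (h : ∀ z ∈ Metric.sphere (0 : EuclideanSpace ℝ (Fin n)) 1, |f z - f p| ≤ ε + C * ‖z - p‖^2)
    {x : EuclideanSpace ℝ (Fin n)} (hx : ‖x‖ ≤ 1) :
    |wc f x - f p| ≤ ε + 2 * C * ((1 - ‖x‖^2) + ‖x - p‖^2) := by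
  rcases hx.lt_or_eq with hx | hx
  · rw [wc_in f hx]
    have hP := poi_cont hx
    have hN := newt_cont hx
    have e1 : (∫ z, poi x z * f z ∂(sphMeas n)) - f p = ∫ z, poi x z * (f z - f p) ∂(sphMeas n) := by
      have : ∀ z, poi x z * (f z - f p) = poi x z * f z - poi x z * f p := fun z => by ring
      simp_rw [this]
      rw [sph_integral_sub hn (f := fun z => poi x z * f z) (g := fun z => poi x z * f p) (hP.mul hf)
        (hP.mul continuousOn_const),
        integral_mul_const, poi_mean hn hx, one_mul]
    rw [e1]
    refine (abs_integral_le_integral_abs).trans ?_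
    have e2 : ∫ z, |poi x z * (f z - f p)| ∂(sphMeas n) ≤
        ∫ z, ((ε + 2 * C * ‖x - p‖^2) * poi x z + (2 * C * (1 - ‖x‖^2)) * newt x z) ∂(sphMeas n) := by
      refine sph_integral_mono hn ?_ ?_ ?_
      · exact (hP.mul (hf.sub continuousOn_const)).abs
      · exact (continuousOn_const.mul hP).add (continuousOn_const.mul hN)
      · intro z hz
        have hz1 : ‖z‖ = 1 := by simpa using hz
        rw [abs_mul, abs_of_nonneg (poi_nonneg hx z), mul_assoc (2 * C), ← poi_newt (ne_of_ball hx hz1)]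
        have k1 : ‖z - p‖^2 ≤ 2 * ‖x - z‖^2 + 2 * ‖x - p‖^2 := by
          have a1 : ‖z - p‖ ≤ ‖x - z‖ + ‖x - p‖ := by
            have : z - p = -(x - z) + (x - p) := by abel
            rw [this]; refine (norm_add_le _ _).trans ?_; rw [norm_neg]
          have := norm_nonneg (z - p)
          nlinarith [sq_nonneg (‖x - z‖ - ‖x - p‖)]
        have k2 := h z hz
        have k3 : |f z - f p| ≤ ε + C * (2 * ‖x - z‖^2 + 2 * ‖x - p‖^2) := by nlinarith
        have := mul_le_mul_of_nonneg_left k3 (poi_nonneg hx z)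
        nlinarith
    refine e2.trans ?_
    rw [sph_integral_add hn (f := fun z => _ * poi x z) (g := fun z => _ * newt x z)
      (continuousOn_const.mul hP) (continuousOn_const.mul hN),
      integral_const_mul, integral_const_mul, poi_mean hn hx, newt_mean hn hx]
    linarith
  · rw [wc_bd f hx, hx]
    have := h x (by simpa using hx)
    have h3 : 0 ≤ C * ‖x - p‖^2 := by positivity
    nlinarith

lemma wc_cont (hn : 0 < n) {f : EuclideanSpace ℝ (Fin n) → ℝ} (hf : ContinuousOn f (Metric.sphere 0 1)) :
    ContinuousOn (wc f) (Metric.closedBall 0 1) := by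
  intro p hp
  have hp : ‖p‖ ≤ 1 := by simpa using hp
  rcases hp.lt_or_eq with hp | hp
  · have h1 := ker_int_cont hn 1 1 (n/2:ℝ) hp hf (ψ := fun z => z) continuousOn_id (fun z hz => by simpa using hz)
    refine (h1.congr ?_).continuousWithinAt
    filter_upwards [Metric.isOpen_ball.mem_nhds (show p ∈ Metric.ball 0 1 by simpa using hp)] with y hy
    rw [wc_in f (by simpa using hy)]; rfl
  · rw [Metric.continuousWithinAt_iff]
    intro ε hε
    have hps : p ∈ Metric.sphere (0 : EuclideanSpace ℝ (Fin n)) 1 := by simpa using hp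
    obtain ⟨δ, hδ, h1⟩ := Metric.continuousWithinAt_iff.1 (hf p hps) (ε/2) (by positivity)
    obtain ⟨M, hM⟩ := (isCompact_sphere (0 : EuclideanSpace ℝ (Fin n)) 1).exists_bound_of_continuousOn hf
    have hM0 : 0 ≤ M := (norm_nonneg _).trans (hM p hps)
    set C := 2 * M / δ^2 with hC
    have hC0 : 0 ≤ C := by positivity
    have h2 : ∀ z ∈ Metric.sphere (0 : EuclideanSpace ℝ (Fin n)) 1, |f z - f p| ≤ ε/2 + C * ‖z - p‖^2 := by
      intro z hz
      have h3 : 0 ≤ C * ‖z - p‖^2 := by positivity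
      by_cases hd : dist z p < δ
      · have := h1 hz hd
        rw [Real.dist_eq] at this
        linarith
      · rw [dist_eq_norm] at hd
        push Not at hd
        have k1 : 2 * M ≤ C * ‖z - p‖^2 := by
          rw [hC, div_mul_eq_mul_div, le_div_iff₀ (by positivity)]
          have : δ^2 ≤ ‖z - p‖^2 := by gcongr
          nlinarith
        have k2 := hM z hz
        have k3 := hM p hps
        rw [Real.norm_eq_abs] at k2 k3
        have := abs_sub (f z) (f p)
        linarith
    have hcont : Tendsto (fun x : EuclideanSpace ℝ (Fin n) => 2 * C * ((1 - ‖x‖^2) + ‖x - p‖^2)) (𝓝 p) (𝓝 0) := by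
      have : Continuous (fun x : EuclideanSpace ℝ (Fin n) => 2 * C * ((1 - ‖x‖^2) + ‖x - p‖^2)) := by fun_prop
      simpa [hp] using this.tendsto p
    obtain ⟨δ', hδ', h4⟩ := Metric.eventually_nhds_iff.1 (hcont.eventually (gt_mem_nhds (show (0:ℝ) < ε/2 by positivity)))
    refine ⟨δ', hδ', fun {x} hx hxp => ?_⟩
    rw [wc_bd f hp, Real.dist_eq]
    have := wc_est hn hf (by positivity) hC0 h2 (x := x) (by simpa using hx)
    have := h4 hxp
    linarith

/-- Poisson representation. -/
lemma poi_repr (hn : 0 < n) (b : OrthonormalBasis (Fin n) ℝ (EuclideanSpace ℝ (Fin n)))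
    {v : EuclideanSpace ℝ (Fin n) → ℝ} (hv : ContinuousOn v (Metric.closedBall 0 1))
    (hh : ∀ x, ‖x‖ < 1 → HarmAt b v x) {x : EuclideanSpace ℝ (Fin n)} (hx : ‖x‖ < 1) :
    v x = ∫ z, poi x z * v z ∂(sphMeas n) := by
  have hvs : ContinuousOn v (Metric.sphere 0 1) := hv.mono Metric.sphere_subset_closedBall
  rw [← wc_in v hx]
  have hbd : ∀ y ∈ Metric.closedBall (0 : EuclideanSpace ℝ (Fin n)) 1 \ Metric.ball 0 1, wc v y = v y := by
    intro y hy
    apply wc_bd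
    simp only [Set.mem_sdiff, Metric.mem_closedBall, dist_zero_right, Metric.mem_ball, not_lt] at hy
    linarith
  have h1 := max_principle hn b (isCompact_closedBall 0 1) Metric.isOpen_ball Metric.ball_subset_closedBall
    (Z := fun y => v y - wc v y) (hv.sub (wc_cont hn hvs))
    (fun y hy => (hh y (by simpa using hy)).sub (wc_harm hn b hvs (by simpa using hy)))
    (fun y hy => by rw [hbd y hy]; simp) x (by simpa using hx.le)
  have h2 := max_principle hn b (isCompact_closedBall 0 1) Metric.isOpen_ball Metric.ball_subset_closedBall
    (Z := fun y => wc v y - v y) ((wc_cont hn hvs).sub hv)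
    (fun y hy => (wc_harm hn b hvs (by simpa using hy)).sub (hh y (by simpa using hy)))
    (fun y hy => by rw [hbd y hy]; simp) x (by simpa using hx.le)
  linarith
end

end

section
open MeasureTheory Filter Topology Set

section
variable {n : ℕ}

noncomputable def kQ (a y : EuclideanSpace ℝ (Fin n)) : ℝ := 1 - 2 * inner ℝ a y + ‖a‖^2 * ‖y‖^2
noncomputable def kN (a y : EuclideanSpace ℝ (Fin n)) : EuclideanSpace ℝ (Fin n) :=
  (‖y - a‖^2) • a - (1 - ‖a‖^2) • (y - a)
noncomputable def kphi (a y : EuclideanSpace ℝ (Fin n)) : EuclideanSpace ℝ (Fin n) := (kQ a y)⁻¹ • kN a y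

lemma kQ_pos {a y : EuclideanSpace ℝ (Fin n)} (ha : ‖a‖ < 1) (hy : ‖y‖ ≤ 1) : 0 < kQ a y := by
  unfold kQ
  have h1 := real_inner_le_norm a y
  have h0 := norm_nonneg a
  have h2 := norm_nonneg y
  have h3 : ‖a‖ * ‖y‖ < 1 := by nlinarith
  nlinarith [mul_pos (sub_pos.2 h3) (sub_pos.2 h3)]

lemma kN_sq (a y : EuclideanSpace ℝ (Fin n)) : ‖kN a y‖^2 = ‖y - a‖^2 * kQ a y := by
  unfold kN kQ
  rw [norm_sub_sq_real, norm_smul, norm_smul, inner_smul_left, inner_smul_right, mul_pow, mul_pow, Real.norm_eq_abs,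
    Real.norm_eq_abs, sq_abs, sq_abs, inner_sub_right, real_inner_self_eq_norm_sq, norm_sub_sq_real, real_inner_comm a y]
  simp only [conj_trivial]
  ring

lemma kphi_sq {a y : EuclideanSpace ℝ (Fin n)} (ha : ‖a‖ < 1) (hy : ‖y‖ ≤ 1) :
    kQ a y * ‖kphi a y‖^2 = ‖y - a‖^2 := by
  have := kQ_pos ha hy
  unfold kphi
  rw [norm_smul, mul_pow, kN_sq, Real.norm_eq_abs, sq_abs]
  field_simp

lemma kphi_one_sub {a y : EuclideanSpace ℝ (Fin n)} (ha : ‖a‖ < 1) (hy : ‖y‖ ≤ 1) :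
    kQ a y * (1 - ‖kphi a y‖^2) = (1 - ‖a‖^2) * (1 - ‖y‖^2) := by
  rw [mul_sub, kphi_sq ha hy]
  unfold kQ
  rw [norm_sub_sq_real, real_inner_comm]
  ring

lemma kphi_lt {a y : EuclideanSpace ℝ (Fin n)} (ha : ‖a‖ < 1) (hy : ‖y‖ < 1) : ‖kphi a y‖ < 1 := by
  have h1 := kphi_one_sub ha hy.le
  have h2 := kQ_pos ha hy.le
  have h3 : 0 < (1 - ‖a‖^2) * (1 - ‖y‖^2) := by
    have := norm_nonneg a
    have := norm_nonneg y
    apply mul_pos <;> nlinarith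
  rw [← h1] at h3
  have := (mul_pos_iff_of_pos_left h2).1 h3
  have := norm_nonneg (kphi a y)
  nlinarith

lemma kphi_eq {a y : EuclideanSpace ℝ (Fin n)} (ha : ‖a‖ < 1) (hy : ‖y‖ = 1) : ‖kphi a y‖ = 1 := by
  have h1 := kphi_one_sub ha hy.le
  have h2 := kQ_pos ha hy.le
  rw [hy] at h1
  norm_num at h1
  rcases h1 with h1 | h1
  · linarith
  · have := norm_nonneg (kphi a y)
    nlinarith

lemma kQ_sphere {a y : EuclideanSpace ℝ (Fin n)} (hy : ‖y‖ = 1) : kQ a y = ‖a - y‖^2 := by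
  unfold kQ
  rw [norm_sub_sq_real, hy]; ring

lemma kphi_key {a y z : EuclideanSpace ℝ (Fin n)} (ha : ‖a‖ < 1) (hy : ‖y‖ ≤ 1) (hz : ‖z‖ = 1) :
    kQ a y * ‖kphi a y - z‖^2 = kQ a z * ‖y - kphi a z‖^2 := by
  have h1 := kQ_pos ha hy
  have h2 := kQ_pos ha hz.le
  have e1 : kQ a y * inner ℝ (kphi a y) z = inner ℝ (kN a y) z := by
    unfold kphi; rw [inner_smul_left]; simp only [conj_trivial]; field_simp
  have e2 : kQ a z * inner ℝ y (kphi a z) = inner ℝ y (kN a z) := by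
    unfold kphi; rw [inner_smul_right]; field_simp
  have l : kQ a y * ‖kphi a y - z‖^2 = ‖y - a‖^2 + kQ a y - 2 * inner ℝ (kN a y) z := by
    rw [norm_sub_sq_real, hz, ← e1, ← kphi_sq ha hy]; ring
  have r : kQ a z * ‖y - kphi a z‖^2 = kQ a z * ‖y‖^2 + kQ a z - 2 * inner ℝ y (kN a z) := by
    rw [norm_sub_sq_real, kphi_eq ha hz, ← e2]; ring
  rw [l, r]
  unfold kN kQ
  simp only [norm_sub_sq_real, hz, inner_sub_left, inner_sub_right, inner_smul_left, inner_smul_right, conj_trivial]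
  rw [real_inner_comm y a, real_inner_comm a z]
  ring

lemma kQ_cont (a : EuclideanSpace ℝ (Fin n)) : Continuous (kQ a) := by unfold kQ; fun_prop
lemma kphi_cont {a : EuclideanSpace ℝ (Fin n)} (ha : ‖a‖ < 1) : ContinuousOn (kphi a) (Metric.closedBall 0 1) := by
  unfold kphi
  refine ContinuousOn.smul ((kQ_cont a).continuousOn.inv₀ fun y hy => (kQ_pos ha (by simpa using hy)).ne') ?_
  unfold kN; fun_prop

lemma kphi_poi {a y z : EuclideanSpace ℝ (Fin n)} (ha : ‖a‖ < 1) (hy : ‖y‖ < 1) (hz : ‖z‖ = 1) :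
    (kQ a y) ^ (-((n-2)/2 : ℝ)) * poi (kphi a y) z =
      poi y (kphi a z) * ((1 - ‖a‖^2) * (kQ a z) ^ (-(n/2:ℝ))) := by
  have h1 := kQ_pos ha hy.le
  have h2 := kQ_pos ha hz.le
  have h3 := kphi_key ha hy.le hz
  have h4 := kphi_one_sub ha hy.le
  unfold poi genKer
  have e1 : (kQ a y) ^ (-(n/2:ℝ)) * (‖kphi a y - z‖^2) ^ (-(n/2:ℝ)) =
      (kQ a z) ^ (-(n/2:ℝ)) * (‖y - kphi a z‖^2) ^ (-(n/2:ℝ)) := by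
    rw [← Real.mul_rpow h1.le (by positivity), ← Real.mul_rpow h2.le (by positivity), h3]
  have e2 : (kQ a y) ^ (-((n-2)/2 : ℝ)) = kQ a y * (kQ a y) ^ (-(n/2:ℝ)) := by
    rw [show -((n-2)/2 : ℝ) = 1 + -(n/2:ℝ) by ring, Real.rpow_add h1, Real.rpow_one]
  rw [e2]
  calc kQ a y * kQ a y ^ (-(n/2:ℝ)) * ((1 - 1 * ‖kphi a y‖ ^ 2) * (‖kphi a y - z‖ ^ 2) ^ (-(n/2:ℝ)))
      = (kQ a y * (1 - ‖kphi a y‖ ^ 2)) * ((kQ a y) ^ (-(n/2:ℝ)) * (‖kphi a y - z‖^2) ^ (-(n/2:ℝ))) := by ring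
    _ = _ := by rw [h4, e1]; ring

/-- Kelvin transform. -/
noncomputable def kv (a : EuclideanSpace ℝ (Fin n)) (u : EuclideanSpace ℝ (Fin n) → ℝ)
    (y : EuclideanSpace ℝ (Fin n)) : ℝ := (kQ a y) ^ (-((n-2)/2 : ℝ)) * u (kphi a y)

lemma kphi_maps {a : EuclideanSpace ℝ (Fin n)} (ha : ‖a‖ < 1) :
    MapsTo (kphi a) (Metric.closedBall 0 1) (Metric.closedBall 0 1) := by
  intro y hy
  have hy : ‖y‖ ≤ 1 := by simpa using hy
  rcases hy.lt_or_eq with h | h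
  · simpa using (kphi_lt ha h).le
  · simpa using (kphi_eq ha h).le

lemma kv_cont {a : EuclideanSpace ℝ (Fin n)} (ha : ‖a‖ < 1) {u : EuclideanSpace ℝ (Fin n) → ℝ}
    (hu : ContinuousOn u (Metric.closedBall 0 1)) : ContinuousOn (kv a u) (Metric.closedBall 0 1) := by
  unfold kv
  refine ContinuousOn.mul ?_ (hu.comp (kphi_cont ha) (kphi_maps ha))
  exact (kQ_cont a).continuousOn.rpow_const fun y hy => Or.inl (kQ_pos ha (by simpa using hy)).ne'

lemma kv_harm (hn : 0 < n) (b : OrthonormalBasis (Fin n) ℝ (EuclideanSpace ℝ (Fin n)))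
    {a : EuclideanSpace ℝ (Fin n)} (ha : ‖a‖ < 1) {u : EuclideanSpace ℝ (Fin n) → ℝ}
    (hu : ContinuousOn u (Metric.closedBall 0 1)) (hh : ∀ x, ‖x‖ < 1 → HarmAt b u x)
    {y : EuclideanSpace ℝ (Fin n)} (hy : ‖y‖ < 1) : HarmAt b (kv a u) y := by
  have hsub : Metric.sphere (0 : EuclideanSpace ℝ (Fin n)) 1 ⊆ Metric.closedBall 0 1 := Metric.sphere_subset_closedBall
  have h1 := ker_harm hn 1 1 (n/2 : ℝ) b hy
    (f := fun z => ((1 - ‖a‖^2) * (kQ a z) ^ (-(n/2:ℝ))) * u z) (ψ := kphi a) ?_ ((kphi_cont ha).mono hsub)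
    (fun z hz => kphi_eq ha (by simpa using hz)) (fun z hz => poisson_lap hn b hy z hz)
  · refine h1.congr ?_
    filter_upwards [Metric.isOpen_ball.mem_nhds (show y ∈ Metric.ball 0 1 by simpa using hy)] with x hx
    have hx : ‖x‖ < 1 := by simpa using hx
    unfold kv
    rw [poi_repr hn b hu hh (kphi_lt ha hx), ← integral_const_mul]
    refine sph_integral_congr hn fun z hz => ?_
    have := kphi_poi ha hx (show ‖z‖ = 1 by simpa using hz)
    rw [← mul_assoc (kQ a x ^ (-((n-2)/2 : ℝ))), this]
    unfold poi; ring
  · refine ContinuousOn.mul (continuousOn_const.mul ?_) (hu.mono hsub)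
    exact (kQ_cont a).continuousOn.rpow_const fun y hy => Or.inl (kQ_pos ha (by simpa using hsub hy)).ne'

lemma kv_sphere {a η : EuclideanSpace ℝ (Fin n)} (u : EuclideanSpace ℝ (Fin n) → ℝ) (hη : ‖η‖ = 1) :
    kv a u η = newt a η * u (kphi a η) := by
  unfold kv newt genKer
  rw [kQ_sphere hη]; ring

lemma kphi_zero (a : EuclideanSpace ℝ (Fin n)) : kphi a 0 = a := by
  unfold kphi kQ kN
  simp [← add_smul]

lemma kQ_hd (a l : EuclideanSpace ℝ (Fin n)) : HasDerivAt (fun t : ℝ => kQ a (t • l)) (-2 * inner ℝ a l) 0 := by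
  have h := hd_line (0 : EuclideanSpace ℝ (Fin n)) l 0
  simp only [zero_add] at h
  have h1 := (((hasDerivAt_const (0:ℝ) a).inner ℝ h).const_mul 2).const_sub 1
  have h2 := (h.norm_sq).const_mul (‖a‖^2)
  unfold kQ
  refine (h1.add h2).congr_deriv ?_
  simp

lemma kphi_hd (a l : EuclideanSpace ℝ (Fin n)) :
    HasDerivAt (fun t : ℝ => kphi a (t • l)) (-(1 - ‖a‖^2) • l) 0 := by
  have h := hd_line (0 : EuclideanSpace ℝ (Fin n)) l 0
  simp only [zero_add] at h
  have h0 : kQ a ((0:ℝ) • l) = 1 := by simp [kQ]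
  have h1 := (kQ_hd a l).inv (by rw [h0]; norm_num)
  have h2 := ((h.sub_const a).norm_sq.smul_const a).sub ((h.sub_const a).const_smul (1 - ‖a‖^2))
  unfold kphi kN
  refine (h1.smul h2).congr_deriv ?_
  simp only [Pi.inv_apply, Pi.sub_apply, Pi.smul_apply, h0]
  simp only [zero_smul, zero_sub, norm_neg, inner_neg_left]
  module

lemma kelvin_deriv (hn : 0 < n) (b : OrthonormalBasis (Fin n) ℝ (EuclideanSpace ℝ (Fin n)))
    {a l : EuclideanSpace ℝ (Fin n)} (ha : ‖a‖ < 1) (hl : ‖l‖ = 1) {u : EuclideanSpace ℝ (Fin n) → ℝ}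
    (hu : ContinuousOn u (Metric.closedBall 0 1)) (hh : ∀ x, ‖x‖ < 1 → HarmAt b u x)
    {D : EuclideanSpace ℝ (Fin n) →L[ℝ] ℝ} (hD : HasFDerivAt u D a) :
    (1 - ‖a‖^2) * D l = ∫ η, ((n-2) * inner ℝ a l - n * inner ℝ η l) * (newt a η * u (kphi a η)) ∂(sphMeas n) := by
  have hsub : Metric.sphere (0 : EuclideanSpace ℝ (Fin n)) 1 ⊆ Metric.closedBall 0 1 := Metric.sphere_subset_closedBall
  have hvc := kv_cont ha hu
  have hvs := hvc.mono hsub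
  have hrep := fun {x : EuclideanSpace ℝ (Fin n)} (hx : ‖x‖ < 1) => poi_repr hn b hvc
    (fun y hy => kv_harm hn b ha hu hh hy) hx
  have d1 := ker_hd hn 1 1 (n/2:ℝ) (x := 0) (by simp) hl hvs (ψ := fun z => z) continuousOn_id
    (fun z hz => by simpa using hz) (t := 0) (by simp)
  have d2 : HasDerivAt (fun t : ℝ => kv a u (t • l)) ((n - 2) * inner ℝ a l * u a - (1 - ‖a‖^2) * D l) 0 := by
    have h0 : kQ a ((0:ℝ) • l) = 1 := by simp [kQ]
    have k0 : kphi a ((0:ℝ) • l) = a := by rw [zero_smul, kphi_zero]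
    have h1 := (kQ_hd a l).rpow_const (p := -((n-2)/2 : ℝ)) (Or.inl (by rw [h0]; norm_num))
    have h2 := HasFDerivAt.comp_hasDerivAt (0:ℝ) (by rw [k0]; exact hD) (kphi_hd a l)
    unfold kv
    refine (h1.mul h2).congr_deriv ?_
    simp only [h0, Function.comp, k0, Real.one_rpow, map_smul, smul_eq_mul]
    ring
  have d3 : HasDerivAt (fun t : ℝ => kv a u (t • l))
      (∫ z, genKer1 1 1 (n/2:ℝ) l (0 + (0:ℝ) • l) z * kv a u z ∂(sphMeas n)) 0 := by
    refine d1.congr_of_eventuallyEq ?_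
    have hc : Continuous (fun t : ℝ => ‖t • l‖) := by fun_prop
    have := hc.tendsto 0
    filter_upwards [this.eventually (gt_mem_nhds (show ‖(0:ℝ) • l‖ < 1 by simp))] with t ht
    rw [hrep ht, zero_add]; rfl
  have e := d2.unique d3
  have e0 : u a = ∫ η, kv a u η ∂(sphMeas n) := by
    have h := hrep (x := 0) (by simp)
    have k : kv a u 0 = u a := by unfold kv; rw [kphi_zero]; simp [kQ]
    rw [← k, h]
    refine sph_integral_congr hn fun z hz => ?_
    have hz : ‖z‖ = 1 := by simpa using hz
    simp [poi, genKer, hz]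
  have e1 : ∫ z, genKer1 1 1 (n/2:ℝ) l (0 + (0:ℝ) • l) z * kv a u z ∂(sphMeas n) =
      ∫ η, n * inner ℝ η l * kv a u η ∂(sphMeas n) := by
    refine sph_integral_congr hn fun z hz => ?_
    have hz : ‖z‖ = 1 := by simpa using hz
    simp only [genKer1, zero_smul, add_zero, zero_sub, norm_neg, hz, inner_neg_left, inner_zero_left, norm_zero]
    simp
    left
    ring
  rw [e1, e0, ← integral_const_mul] at e
  have e2 : (1 - ‖a‖^2) * D l = (∫ η, (n-2) * inner ℝ a l * kv a u η ∂(sphMeas n)) -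
      ∫ η, n * inner ℝ η l * kv a u η ∂(sphMeas n) := by linarith
  rw [e2, ← sph_integral_sub hn (f := fun η => (n-2) * inner ℝ a l * kv a u η)
    (g := fun η => n * inner ℝ η l * kv a u η) (continuousOn_const.mul hvs)
    (ContinuousOn.mul (by fun_prop) hvs)]
  refine sph_integral_congr hn fun z hz => ?_
  rw [← kv_sphere u (show ‖z‖ = 1 by simpa using hz)]
  ring

lemma kelvin_bound (hn : 0 < n) (b : OrthonormalBasis (Fin n) ℝ (EuclideanSpace ℝ (Fin n)))
    {a l : EuclideanSpace ℝ (Fin n)} (ha : ‖a‖ < 1) (hl : ‖l‖ = 1) {u : EuclideanSpace ℝ (Fin n) → ℝ}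
    (hu : ContinuousOn u (Metric.closedBall 0 1)) (hh : ∀ x, ‖x‖ < 1 → HarmAt b u x)
    (hu1 : ∀ x, ‖x‖ = 1 → |u x| ≤ 1)
    {D : EuclideanSpace ℝ (Fin n) →L[ℝ] ℝ} (hD : HasFDerivAt u D a) :
    (1 - ‖a‖^2) * |D l| ≤ 2 * n * ∫ η, max ((n-2)/n * inner ℝ a l - inner ℝ η l) 0 * newt a η ∂(sphMeas n) := by
  have hn' : (0:ℝ) < n := by exact_mod_cast hn
  have h1 := kelvin_deriv hn b ha hl hu hh hD
  have h0 := kelvin_deriv hn b ha hl (u := fun _ => 1) continuousOn_const (fun x _ => HarmAt.const b 1 x)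
    (hasFDerivAt_const 1 a)
  simp only [_root_.zero_apply, mul_zero, mul_one] at h0
  have hN := newt_cont ha
  have hsub : Metric.sphere (0 : EuclideanSpace ℝ (Fin n)) 1 ⊆ Metric.closedBall 0 1 := Metric.sphere_subset_closedBall
  have hk : ContinuousOn (fun η => u (kphi a η)) (Metric.sphere 0 1) :=
    (hu.comp (kphi_cont ha) (kphi_maps ha)).mono hsub
  have hlin : ContinuousOn (fun η : EuclideanSpace ℝ (Fin n) => (n-2) * inner ℝ a l - n * inner ℝ η l)
    (Metric.sphere 0 1) := by fun_prop
  have ha' : 0 ≤ 1 - ‖a‖^2 := by have := norm_nonneg a; nlinarith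
  have h2 : (1 - ‖a‖^2) * |D l| = |(1 - ‖a‖^2) * D l| := by rw [abs_mul, abs_of_nonneg ha']
  rw [h2, h1]
  refine abs_integral_le_integral_abs.trans ?_
  have hmax : ContinuousOn (fun η : EuclideanSpace ℝ (Fin n) =>
      max ((n-2)/n * inner ℝ a l - inner ℝ η l) 0 * newt a η) (Metric.sphere 0 1) :=
    ContinuousOn.mul (by fun_prop) hN
  have h3 : ∫ η, |((n-2) * inner ℝ a l - n * inner ℝ η l) * (newt a η * u (kphi a η))| ∂(sphMeas n) ≤
      ∫ η, (2 * n * (max ((n-2)/n * inner ℝ a l - inner ℝ η l) 0 * newt a η)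
        - ((n-2) * inner ℝ a l - n * inner ℝ η l) * newt a η) ∂(sphMeas n) := by
    refine sph_integral_mono hn (hlin.mul (hN.mul hk)).abs
      ((continuousOn_const.mul hmax).sub (hlin.mul hN)) ?_
    intro z hz
    have hz : ‖z‖ = 1 := by simpa using hz
    have k1 := hu1 _ (kphi_eq ha hz)
    have k2 := newt_nonneg a z
    rw [abs_mul, abs_mul, abs_of_nonneg k2]
    have k3 : |((n:ℝ)-2) * inner ℝ a l - n * inner ℝ z l| =
        2 * n * max ((n-2)/n * inner ℝ a l - inner ℝ z l) 0 - ((n-2) * inner ℝ a l - n * inner ℝ z l) := by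
      have e : ((n:ℝ)-2) * inner ℝ a l - n * inner ℝ z l = n * ((n-2)/n * inner ℝ a l - inner ℝ z l) := by
        field_simp
      rw [e]
      set w : ℝ := (n-2)/n * inner ℝ a l - inner ℝ z l
      rw [abs_mul, abs_of_pos hn']
      rcases le_total w 0 with h | h
      · rw [abs_of_nonpos h, max_eq_right h]; ring
      · rw [abs_of_nonneg h, max_eq_left h]; ring
    rw [show 2 * (n:ℝ) * (max ((n-2)/n * inner ℝ a l - inner ℝ z l) 0 * newt a z)
        - ((n-2) * inner ℝ a l - n * inner ℝ z l) * newt a z =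
        |((n:ℝ)-2) * inner ℝ a l - n * inner ℝ z l| * newt a z by rw [k3]; ring]
    refine mul_le_mul_of_nonneg_left ?_ (abs_nonneg _)
    nlinarith
  refine h3.trans ?_
  rw [sph_integral_sub hn (f := fun η => 2 * n * (max ((n-2)/n * inner ℝ a l - inner ℝ η l) 0 * newt a η))
    (g := fun η => ((n-2) * inner ℝ a l - n * inner ℝ η l) * newt a η) (continuousOn_const.mul hmax) (hlin.mul hN),
    ← h0, integral_const_mul]
  simp
end

end

section
open MeasureTheory Filter Topology Set

section
variable {n : ℕ}

lemma wc_nonneg (hn : 0 < n) {f : EuclideanSpace ℝ (Fin n) → ℝ} (hf : ∀ z, 0 ≤ f z)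
    (x : EuclideanSpace ℝ (Fin n)) : 0 ≤ wc f x := by
  by_cases hx : ‖x‖ < 1
  · rw [wc_in f hx]
    exact sph_integral_nonneg hn fun z _ => mul_nonneg (poi_nonneg hx z) (hf z)
  · unfold wc; rw [if_neg hx]; exact hf x

lemma wc_ge (hn : 0 < n) (c : ℝ) (l : EuclideanSpace ℝ (Fin n)) {x : EuclideanSpace ℝ (Fin n)} (hx : ‖x‖ ≤ 1) :
    max (c - inner ℝ x l) 0 ≤ wc (fun η => max (c - inner ℝ η l) 0) x := by
  refine max_le ?_ (wc_nonneg hn (fun z => le_max_right _ _) x)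
  rcases hx.lt_or_eq with hx | hx
  · rw [wc_in _ hx, poi_repr hn (EuclideanSpace.basisFun (Fin n) ℝ) (v := fun y => c - inner ℝ y l) (by fun_prop)
      (fun y _ => HarmAt.affine _ c l y) hx]
    refine sph_integral_mono hn ((poi_cont hx).mul (by fun_prop)) ((poi_cont hx).mul (by fun_prop)) ?_
    intro z _
    exact mul_le_mul_of_nonneg_left (le_max_left _ _) (poi_nonneg hx z)
  · rw [wc_bd _ hx]; exact le_max_left _ _

lemma wc_reflect (hn : 0 < n) (c : ℝ) {l w : EuclideanSpace ℝ (Fin n)} (hw : inner ℝ w l = (0:ℝ)) (s : ℝ)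
    (hp : ‖s • l + w‖ < 1) :
    wc (fun η => max (c - inner ℝ η l) 0) (s • l + w) ≤ wc (fun η => max (c - inner ℝ η l) 0) (s • l) := by
  by_cases hw0 : w = 0
  · subst hw0; simp
  set f : EuclideanSpace ℝ (Fin n) → ℝ := fun η => max (c - inner ℝ η l) 0 with hf
  have hfc : ContinuousOn f (Metric.sphere 0 1) := by rw [hf]; fun_prop
  have hwpos : 0 < ‖w‖^2 := by positivity
  let R : EuclideanSpace ℝ (Fin n) ≃ₗᵢ[ℝ] EuclideanSpace ℝ (Fin n) := (ℝ ∙ w)ᗮ.reflection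
  have hR : ∀ y, R y = y - (2 * (inner ℝ w y / ‖w‖^2)) • w := by
    intro y
    change (ℝ ∙ w)ᗮ.reflection y = _
    rw [Submodule.reflection_orthogonal_apply, Submodule.reflection_singleton_apply]
    simp only [RCLike.ofReal_real_eq_id, id]
    module
  let st : EuclideanSpace ℝ (Fin n) → EuclideanSpace ℝ (Fin n) := fun y => R y + w
  have hst_l : ∀ y, inner ℝ (st y) l = inner ℝ y l := by
    intro y
    simp only [st, hR, inner_add_left, inner_sub_left, inner_smul_left, hw]
    simp
  have hst_n : ∀ y, ‖st y‖^2 = ‖y‖^2 + ‖w‖^2 - 2 * inner ℝ w y := by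
    intro y
    have : inner ℝ (R y) w = - inner ℝ w y := by
      rw [hR, inner_sub_left, inner_smul_left, real_inner_self_eq_norm_sq, real_inner_comm]
      simp only [conj_trivial]
      field_simp; ring
    simp only [st]
    rw [norm_add_sq_real, R.norm_map, this]; ring
  have hst_c : Continuous st := R.continuous.add continuous_const
  let b := EuclideanSpace.basisFun (Fin n) ℝ
  have hnn := fun y : EuclideanSpace ℝ (Fin n) => norm_nonneg y
  have key := max_principle hn b (K := Metric.closedBall 0 1 ∩ {y | ‖w‖^2/2 ≤ inner ℝ w y})
    (Ω := Metric.ball 0 1 ∩ {y | ‖w‖^2/2 < inner ℝ w y}) (Z := fun y => wc f y - wc f (st y)) ?_ ?_ ?_ ?_ ?_ ?_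
    (s • l + w) ?_
  · have e : st (s • l + w) = s • l := by
      have : inner ℝ w (s • l + w) = ‖w‖^2 := by
        rw [inner_add_right, inner_smul_right, hw, real_inner_self_eq_norm_sq]; ring
      simp only [st, hR, this, div_self hwpos.ne']
      module
    rw [e] at key
    linarith
  · exact (isCompact_closedBall 0 1).inter_right (isClosed_le (by fun_prop) (by fun_prop))
  · exact Metric.isOpen_ball.inter (isOpen_lt (by fun_prop) (by fun_prop))
  · rintro y ⟨h1, h2⟩
    have h2 : ‖w‖^2/2 < inner ℝ w y := h2
    exact ⟨Metric.ball_subset_closedBall h1, show ‖w‖^2/2 ≤ inner ℝ w y from h2.le⟩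
  · refine ContinuousOn.sub ((wc_cont hn hfc).mono inter_subset_left) ?_
    refine (wc_cont hn hfc).comp hst_c.continuousOn ?_
    rintro y ⟨h1, h2⟩
    have h1 : ‖y‖ ≤ 1 := by simpa using h1
    have h2 : ‖w‖^2/2 ≤ inner ℝ w y := h2
    have := hst_n y
    simp only [Metric.mem_closedBall, dist_zero_right]
    nlinarith [hnn y, hnn (st y)]
  · rintro y ⟨h1, h2⟩
    have h1 : ‖y‖ < 1 := by simpa using h1
    have h2 : ‖w‖^2/2 < inner ℝ w y := h2
    refine (wc_harm hn b hfc h1).sub ?_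
    have h3 : ‖st y‖ < 1 := by
      have := hst_n y
      nlinarith [hnn y, hnn (st y)]
    obtain ⟨d, hd, h⟩ := wc_harm hn (b.map R) hfc h3
    refine ⟨d, hd, fun i => ?_⟩
    obtain ⟨g, hg1, hg2⟩ := h i
    refine ⟨g, ?_, hg2⟩
    have e : ∀ t : ℝ, st (y + t • b i) = st y + t • (b.map R) i := by
      intro t
      simp only [st, map_add, map_smul, OrthonormalBasis.map_apply]
      abel
    simp only [e]
    exact hg1
  · rintro y ⟨⟨h1, h2⟩, h3⟩
    have h1 : ‖y‖ ≤ 1 := by simpa using h1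
    have h2 : ‖w‖^2/2 ≤ inner ℝ w y := h2
    have h4 : ‖st y‖ ≤ 1 := by
      have := hst_n y
      nlinarith [hnn y, hnn (st y)]
    rcases h1.lt_or_eq with h1 | h1
    · have h5 : inner ℝ w y = ‖w‖^2/2 := by
        by_contra hne
        exact h3 ⟨by simpa using h1, lt_of_le_of_ne h2 (Ne.symm hne)⟩
      have : st y = y := by
        simp only [st, hR, h5]
        rw [show 2 * (‖w‖^2/2/‖w‖^2) = (1:ℝ) by field_simp]
        module
      rw [this]; simp
    · have := wc_ge hn c l h4
      rw [hst_l] at this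
      rw [wc_bd f h1]
      linarith
  · refine ⟨by simpa using hp.le, ?_⟩
    change ‖w‖^2/2 ≤ inner ℝ w (s • l + w)
    rw [inner_add_right, inner_smul_right, hw, real_inner_self_eq_norm_sq]
    linarith

lemma newt_ray_hd (hn : 0 < n) {x : EuclideanSpace ℝ (Fin n)} (hx : ‖x‖ < 1)
    {f : EuclideanSpace ℝ (Fin n) → ℝ} (hf : ContinuousOn f (Metric.sphere 0 1)) {t : ℝ} (h0 : 0 ≤ t) (h1 : t ≤ 1) :
    HasDerivAt (fun t : ℝ => ∫ z, newt (t • x) z * f z ∂(sphMeas n))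
      (∫ z, genKer1 1 0 ((n-2)/2:ℝ) x (t • x) z * f z ∂(sphMeas n)) t := by
  have hx0 := norm_nonneg x
  set ρ : ℝ := 2 / (1 + ‖x‖) with hρ
  have hρ1 : 1 < ρ := by rw [hρ, lt_div_iff₀ (by positivity)]; linarith
  have hρ2 : ρ * ‖x‖ < 1 := by rw [hρ, div_mul_eq_mul_div, div_lt_iff₀ (by positivity)]; linarith
  have hne : ∀ t ∈ Icc (-ρ) ρ, ∀ z ∈ Metric.sphere (0 : EuclideanSpace ℝ (Fin n)) 1, t • x ≠ z := by
    intro t ht z hz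
    have hz : ‖z‖ = 1 := by simpa using hz
    refine ne_of_ball ?_ hz
    rw [norm_smul, Real.norm_eq_abs]
    have := abs_le.2 ht
    nlinarith
  refine sph_hasDerivAt hn (F' := fun t z => genKer1 1 0 ((n-2)/2:ℝ) x (t • x) z * f z)
    (s := Icc (-ρ) ρ) (Icc_mem_nhds (by linarith) (by linarith)) isCompact_Icc ?_ ?_ ?_
  · intro t ht
    exact (genKer_cont 1 0 _ continuousOn_const continuousOn_id (hne t ht)).mul hf
  · refine ContinuousOn.mul (genKer1_cont 1 0 _ x (p := fun w : ℝ × EuclideanSpace ℝ (Fin n) => w.1 • x)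
      (q := fun w => w.2) (by fun_prop) (by fun_prop) ?_) ?_
    · intro w hw
      exact hne _ hw.1 _ hw.2
    · exact hf.comp continuousOn_snd fun w hw => hw.2
  · intro t ht z hz
    have := (genKer_hd 1 0 ((n-2)/2:ℝ) 0 z x t (by rw [zero_add]; exact hne t ht z hz)).mul_const (f z)
    simp only [zero_add] at this
    exact this

lemma newt_euler {x z : EuclideanSpace ℝ (Fin n)} {t : ℝ} (h : t • x ≠ z) (hz : ‖z‖ = 1) :
    ((n-2)/2:ℝ) * newt (t • x) z + t * genKer1 1 0 ((n-2)/2:ℝ) x (t • x) z = ((n-2)/2:ℝ) * poi (t • x) z := by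
  have hxz : 0 < ‖t • x - z‖^2 := by
    have : t • x - z ≠ 0 := sub_ne_zero.2 h
    positivity
  unfold newt poi genKer genKer1
  have e1 : (‖t • x - z‖^2) ^ (-((n-2)/2 : ℝ)) = (‖t • x - z‖^2) ^ (-(n/2 : ℝ)) * ‖t • x - z‖^2 := by
    rw [← Real.rpow_add_one hxz.ne']; congr 1; ring
  have e2 : (-((n-2)/2 : ℝ) - 1) = -(n/2:ℝ) := by ring
  have e3 : t * inner ℝ (t • x - z) x = ‖t • x‖^2 - inner ℝ (t • x) z := by
    rw [inner_sub_left, inner_smul_left, inner_smul_left, real_inner_self_eq_norm_sq, norm_smul, mul_pow,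
      Real.norm_eq_abs, sq_abs, real_inner_comm]
    simp only [conj_trivial]; ring
  have e4 : ‖t • x - z‖^2 = ‖t • x‖^2 - 2 * inner ℝ (t • x) z + 1 := by
    rw [norm_sub_sq_real, hz]; ring
  rw [e1, e2]
  set p := (‖t • x - z‖^2) ^ (-(n/2 : ℝ))
  calc _ = ((n-2)/2:ℝ) * p * (‖t • x - z‖^2 - 2 * (t * inner ℝ (t • x - z) x)) := by ring
    _ = _ := by rw [e3, e4]; ring

lemma reduce_axis (hn : 3 ≤ n) (c : ℝ) {x l : EuclideanSpace ℝ (Fin n)} (hx : ‖x‖ < 1) (hl : ‖l‖ = 1) :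
    ∫ η, max (c - inner ℝ η l) 0 * newt x η ∂(sphMeas n) ≤
      ∫ η, max (c - inner ℝ η l) 0 * newt ((inner ℝ x l : ℝ) • l) η ∂(sphMeas n) := by
  have hn0 : 0 < n := by omega
  set s : ℝ := inner ℝ x l with hs
  set y : EuclideanSpace ℝ (Fin n) := s • l with hy
  set w := x - s • l with hw
  have hwl : inner ℝ w l = (0:ℝ) := by
    rw [hw, inner_sub_left, inner_smul_left, real_inner_self_eq_norm_sq, hl, ← hs]; simp
  have hy1 : ‖y‖ < 1 := by
    rw [hy, norm_smul, hl, mul_one, Real.norm_eq_abs]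
    have := abs_real_inner_le_norm x l
    rw [hl, mul_one] at this
    linarith
  set f : EuclideanSpace ℝ (Fin n) → ℝ := fun η => max (c - inner ℝ η l) 0 with hf
  have hfc : ContinuousOn f (Metric.sphere 0 1) := by rw [hf]; fun_prop
  set lam : ℝ := (n-2)/2 with hlam
  have hlam0 : 0 < lam := by
    have : (3:ℝ) ≤ n := by exact_mod_cast hn
    rw [hlam]; linarith
  let g : EuclideanSpace ℝ (Fin n) → ℝ → ℝ := fun x t => ∫ z, newt (t • x) z * f z ∂(sphMeas n)
  let g' : EuclideanSpace ℝ (Fin n) → ℝ → ℝ := fun x t => ∫ z, genKer1 1 0 lam x (t • x) z * f z ∂(sphMeas n)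
  have hg : ∀ x : EuclideanSpace ℝ (Fin n), ‖x‖ < 1 → ∀ t, 0 ≤ t → t ≤ 1 → HasDerivAt (g x) (g' x t) t :=
    fun x hx t h0 h1 => newt_ray_hd hn0 hx hfc h0 h1
  have he : ∀ x : EuclideanSpace ℝ (Fin n), ‖x‖ < 1 → ∀ t, 0 ≤ t → t ≤ 1 →
      lam * g x t + t * g' x t = lam * wc f (t • x) := by
    intro x hx t h0 h1
    have htx : ‖t • x‖ < 1 := by
      rw [norm_smul, Real.norm_eq_abs, abs_of_nonneg h0]
      have := norm_nonneg x
      nlinarith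
    rw [wc_in f htx]
    simp only [g, g']
    rw [← integral_const_mul, ← integral_const_mul, ← integral_const_mul]
    have hne : ∀ z ∈ Metric.sphere (0 : EuclideanSpace ℝ (Fin n)) 1, t • x ≠ z := fun z hz =>
      ne_of_ball htx (by simpa using hz)
    rw [← sph_integral_add hn0 (f := fun z => lam * (newt (t • x) z * f z))
      (g := fun z => t * (genKer1 1 0 lam x (t • x) z * f z))
      (continuousOn_const.mul ((newt_cont htx).mul hfc))
      (continuousOn_const.mul ((genKer1_cont 1 0 lam x continuousOn_const continuousOn_id hne).mul hfc))]
    refine sph_integral_congr hn0 fun z hz => ?_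
    have := newt_euler (hne z hz) (show ‖z‖ = 1 by simpa using hz)
    rw [← hlam] at this
    rw [← mul_assoc lam (poi _ _), ← this]; ring
  have hd : ∀ t, 0 < t → t ≤ 1 → HasDerivAt (fun t => t ^ lam * (g x t - g y t))
      (t ^ (lam - 1) * (lam * (wc f (t • x) - wc f (t • y)))) t := by
    intro t h0 h1
    have a1 := Real.hasDerivAt_rpow_const (x := t) (p := lam) (Or.inl h0.ne')
    refine (a1.mul ((hg x hx t h0.le h1).sub (hg y hy1 t h0.le h1))).congr_deriv ?_
    have b1 := he x hx t h0.le h1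
    have b2 := he y hy1 t h0.le h1
    have : t ^ lam = t ^ (lam - 1) * t := by rw [← Real.rpow_add_one h0.ne']; congr 1; ring
    rw [this, mul_sub lam, ← b1, ← b2]
    simp only [Pi.sub_apply]
    ring
  have hneg : ∀ t : ℝ, 0 < t → t ≤ 1 → wc f (t • x) ≤ wc f (t • y) := by
    intro t h0 h1
    have e1 : t • x = (t * s) • l + t • w := by rw [hw]; module
    have e2 : t • y = (t * s) • l := by rw [hy]; module
    rw [e1, e2]
    refine wc_reflect hn0 c (by rw [inner_smul_left, hwl]; simp) _ ?_
    rw [← e1, norm_smul, Real.norm_eq_abs, abs_of_pos h0]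
    have := norm_nonneg x
    nlinarith
  have hanti : AntitoneOn (fun t => t ^ lam * (g x t - g y t)) (Icc 0 1) := by
    refine antitoneOn_of_deriv_nonpos (convex_Icc 0 1) ?_ ?_ ?_
    · intro t ht
      refine ContinuousAt.continuousWithinAt ?_
      exact (Real.continuousAt_rpow_const t lam (Or.inr hlam0.le)).mul
        ((hg x hx t ht.1 ht.2).continuousAt.sub (hg y hy1 t ht.1 ht.2).continuousAt)
    · intro t ht
      rw [interior_Icc] at ht
      exact (hd t ht.1 ht.2.le).differentiableAt.differentiableWithinAt
    · intro t ht
      rw [interior_Icc] at ht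
      rw [(hd t ht.1 ht.2.le).deriv]
      have := hneg t ht.1 ht.2.le
      refine mul_nonpos_of_nonneg_of_nonpos (Real.rpow_nonneg ht.1.le _) ?_
      nlinarith
  have := hanti (left_mem_Icc.2 zero_le_one) (right_mem_Icc.2 zero_le_one) zero_le_one
  simp only [Real.one_rpow, one_mul, Real.zero_rpow hlam0.ne', zero_mul, g, one_smul] at this
  have e : ∀ x : EuclideanSpace ℝ (Fin n), ∫ z, newt x z * f z ∂(sphMeas n) = ∫ z, f z * newt x z ∂(sphMeas n) :=
    fun x => integral_congr_ae (Eventually.of_forall fun z => mul_comm _ _)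
  rw [e, e] at this
  linarith
end

end

section
open MeasureTheory Filter Topology Set

section
variable {n : ℕ}

noncomputable def sMom (l : EuclideanSpace ℝ (Fin n)) (k : ℕ) : ℝ := ∫ z, (inner ℝ z l : ℝ)^k ∂(sphMeas n)

lemma sMom_norm (hn : 0 < n) {l p : EuclideanSpace ℝ (Fin n)} (hl : ‖l‖ = 1) (k : ℕ) :
    sMom p k = ‖p‖^k * sMom l k := by
  obtain ⟨L, hL, -⟩ := exists_isometry (x := ‖p‖ • l) (y := p) (by rw [norm_smul, hl]; simp)
  unfold sMom
  rw [← sph_integral_comp L (fun z => (inner ℝ z p : ℝ)^k), ← hL, ← integral_const_mul]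
  congr 1; ext z
  rw [L.inner_map_map, inner_smul_right, mul_pow, hL]

lemma sMom_line_hd (hn : 0 < n) (l b : EuclideanSpace ℝ (Fin n)) (k : ℕ) (j : ℕ) (t : ℝ) :
    HasDerivAt (fun t : ℝ => ∫ z, (inner ℝ z (l + t • b) : ℝ)^(k+1) * (inner ℝ z b)^j ∂(sphMeas n))
      (∫ z, (k+1) * ((inner ℝ z (l + t • b) : ℝ)^k * (inner ℝ z b)^(j+1)) ∂(sphMeas n)) t := by
  refine sph_hasDerivAt hn (F' := fun t z => (k+1) * ((inner ℝ z (l + t • b) : ℝ)^k * (inner ℝ z b)^(j+1)))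
    (s := Icc (t-1) (t+1)) (Icc_mem_nhds (by linarith) (by linarith)) isCompact_Icc ?_ ?_ ?_
  · intro t _; fun_prop
  · apply Continuous.continuousOn
    unfold Function.uncurry
    fun_prop
  · intro t _ z _
    have h := ((hasDerivAt_const t z).inner ℝ (hd_line l b t)).pow (k+1)
    refine (h.mul_const ((inner ℝ z b)^j)).congr_deriv ?_
    simp
    ring

lemma sMom_second (hn : 0 < n) {l b : EuclideanSpace ℝ (Fin n)} (hl : ‖l‖ = 1) (hb : ‖b‖ = 1) (k : ℕ) :
    ∫ z, (k+2) * ((k+1) * ((inner ℝ z l : ℝ)^k * (inner ℝ z b)^2)) ∂(sphMeas n) =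
      ((k+2) + (k+2) * k * (inner ℝ l b)^2) * sMom l (k+2) := by
  set m : ℝ := -((k+2)/2) with hm
  have hev : ∀ᶠ t : ℝ in 𝓝 0, l + t • b ≠ 0 := by
    have hc : Continuous (fun t : ℝ => l + t • b) := by fun_prop
    have hl0 : l ≠ 0 := by intro h; simp [h] at hl
    have := hc.tendsto 0
    simp only [zero_smul, add_zero] at this
    exact this.eventually_ne hl0
  have e : ∀ t : ℝ, ∫ z, (inner ℝ z (l + t • b) : ℝ)^(k+1+1) * (inner ℝ z b)^0 ∂(sphMeas n) =
      genKer 1 0 m (l + t • b) 0 * sMom l (k+2) := by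
    intro t
    simp only [pow_zero, mul_one]
    change sMom (l + t • b) (k+2) = _
    rw [sMom_norm hn hl]
    congr 1
    unfold genKer
    rw [hm, neg_neg, sub_zero, ← Real.rpow_natCast_mul (norm_nonneg _), ← Real.rpow_natCast]
    rw [zero_mul, sub_zero, one_mul]
    congr 1
    push_cast; ring
  have e1 : ∀ᶠ t : ℝ in 𝓝 0, ∫ z, (k+2) * ((inner ℝ z (l + t • b) : ℝ)^(k+1) * (inner ℝ z b)^1) ∂(sphMeas n) =
      genKer1 1 0 m b (l + t • b) 0 * sMom l (k+2) := by
    filter_upwards [hev] with t ht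
    have h1 := sMom_line_hd hn l b (k+1) 0 t
    simp only [e] at h1
    have h2 := (genKer_hd 1 0 m l 0 b t ht).mul_const (sMom l (k+2))
    rw [← h1.unique h2]
    push_cast
    congr 1; ext z; ring
  have d1 := (genKer1_hd 1 0 m l 0 b hb 0 (by simpa using hev.self_of_nhds)).mul_const (sMom l (k+2))
  have d2 := (sMom_line_hd hn l b k 1 0).const_mul ((k:ℝ)+2)
  simp only [← integral_const_mul] at d2
  have d3 := d1.congr_of_eventuallyEq (e1.mono fun t ht => ht)
  have := d2.unique d3
  simp only [zero_smul, add_zero] at this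
  rw [this]
  congr 1
  unfold genKer2
  rw [sub_zero, hl, hm]
  simp
  ring

lemma sMom_rec (hn : 0 < n) {l : EuclideanSpace ℝ (Fin n)} (hl : ‖l‖ = 1) (k : ℕ) :
    ((n:ℝ) + k) * sMom l (k+2) = (k+1) * sMom l k := by
  let b := EuclideanSpace.basisFun (Fin n) ℝ
  have h1 : ∑ i, ∫ z, (k+2) * ((k+1) * ((inner ℝ z l : ℝ)^k * (inner ℝ z (b i))^2)) ∂(sphMeas n) =
      ∑ i, ((k+2) + (k+2) * k * (inner ℝ l (b i))^2) * sMom l (k+2) :=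
    Finset.sum_congr rfl fun i _ => sMom_second hn hl (b.norm_eq_one i) k
  have e2 : ∀ z : EuclideanSpace ℝ (Fin n), ∑ i, (inner ℝ z (b i) : ℝ)^2 = ‖z‖^2 := by
    intro z
    rw [← real_inner_self_eq_norm_sq, ← b.sum_inner_mul_inner]
    exact Finset.sum_congr rfl fun i _ => by rw [real_inner_comm (b i) z, sq]
  rw [← integral_finsetSum _ fun i _ => sph_integrable hn (by fun_prop)] at h1
  rw [sph_integral_congr hn (g := fun z => ((k+2) * (k+1)) * (inner ℝ z l : ℝ)^k)] at h1
  · rw [integral_const_mul, ← Finset.sum_mul, Finset.sum_add_distrib, ← Finset.mul_sum, e2, hl] at h1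
    simp only [Finset.sum_const, Finset.card_univ, Fintype.card_fin, nsmul_eq_mul] at h1
    change _ * sMom l k = _ at h1
    have hk : (0:ℝ) < k + 2 := by positivity
    apply mul_left_cancel₀ hk.ne'
    linarith
  · intro z hz
    have hz : ‖z‖ = 1 := by simpa using hz
    have := e2 z
    rw [hz] at this
    rw [← Finset.mul_sum, ← Finset.mul_sum, ← Finset.mul_sum, this]; ring

noncomputable def cMom (m k : ℕ) : ℝ := ∫ θ in (0:ℝ)..Real.pi, (Real.cos θ)^k * (Real.sin θ)^m

lemma cMom_rec (m k : ℕ) : ((m:ℝ) + 2 + k) * cMom m (k+2) = (k+1) * cMom m k := by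
  have h : ∀ θ : ℝ, HasDerivAt (fun θ => (Real.cos θ)^(k+1) * (Real.sin θ)^(m+1))
      ((m+2+k) * ((Real.cos θ)^(k+2) * (Real.sin θ)^m) - (k+1) * ((Real.cos θ)^k * (Real.sin θ)^m)) θ := by
    intro θ
    refine (((Real.hasDerivAt_cos θ).pow (k+1)).mul ((Real.hasDerivAt_sin θ).pow (m+1))).congr_deriv ?_
    simp only [Pi.pow_apply]
    push_cast
    have := Real.sin_sq_add_cos_sq θ
    have h2 : Real.sin θ ^ 2 = 1 - Real.cos θ ^ 2 := by linarith
    linear_combination (-((k:ℝ)+1) * Real.cos θ ^ k * Real.sin θ ^ m) * h2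
  have h2 := intervalIntegral.integral_eq_sub_of_hasDerivAt (a := 0) (b := Real.pi) (fun θ _ => h θ)
    (Continuous.intervalIntegrable (by fun_prop) _ _)
  rw [intervalIntegral.integral_sub (Continuous.intervalIntegrable (by fun_prop) _ _)
    (Continuous.intervalIntegrable (by fun_prop) _ _), intervalIntegral.integral_const_mul,
    intervalIntegral.integral_const_mul] at h2
  simp at h2
  unfold cMom
  linarith

lemma cMom_one (m : ℕ) : cMom m 1 = 0 := by
  unfold cMom
  have h : ∀ θ : ℝ, HasDerivAt (fun θ => (Real.sin θ)^(m+1) / (m+1)) ((Real.cos θ)^1 * (Real.sin θ)^m) θ := by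
    intro θ
    refine (((Real.hasDerivAt_sin θ).pow (m+1)).div_const _).congr_deriv ?_
    have : (m:ℝ) + 1 ≠ 0 := by positivity
    push_cast
    field_simp
  rw [intervalIntegral.integral_eq_sub_of_hasDerivAt (a := 0) (b := Real.pi) (fun θ _ => h θ)
    (Continuous.intervalIntegrable (by fun_prop) _ _)]
  simp

lemma cMom_zero_pos (m : ℕ) : 0 < cMom m 0 := by
  unfold cMom; simp only [pow_zero, one_mul]; exact integral_sin_pow_pos m

lemma sMom_one {l : EuclideanSpace ℝ (Fin n)} : sMom l 1 = 0 := by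
  have := sph_integral_comp (LinearIsometryEquiv.neg ℝ) (fun z : EuclideanSpace ℝ (Fin n) => (inner ℝ z l : ℝ)^1)
  simp only [LinearIsometryEquiv.coe_neg, inner_neg_left, pow_one, integral_neg] at this
  unfold sMom
  simp only [pow_one]
  linarith

lemma cMom_sMom (hn : 2 ≤ n) {l : EuclideanSpace ℝ (Fin n)} (hl : ‖l‖ = 1) (k : ℕ) :
    cMom (n-2) k = cMom (n-2) 0 * sMom l k := by
  have hn' : (((n-2:ℕ):ℝ) + 2) = n := by rw [Nat.cast_sub hn]; push_cast; ring
  induction k using Nat.twoStepInduction with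
  | zero => simp [sMom]
  | one => rw [cMom_one, sMom_one]; simp
  | more k ih _ =>
    have h1 := cMom_rec (n-2) k
    have h2 := sMom_rec (by omega) hl k
    rw [hn'] at h1
    have : (0:ℝ) < n + k := by
      have : (0:ℝ) < n := by exact_mod_cast (by omega : 0 < n)
      positivity
    apply mul_left_cancel₀ this.ne'
    rw [h1, ih]
    linear_combination -(cMom (n-2) 0) * h2

lemma density_poly (hn : 2 ≤ n) {l : EuclideanSpace ℝ (Fin n)} (hl : ‖l‖ = 1) (p : Polynomial ℝ) :
    ∫ θ in (0:ℝ)..Real.pi, p.eval (Real.cos θ) * (Real.sin θ)^(n-2) =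
      cMom (n-2) 0 * ∫ z, p.eval (inner ℝ z l) ∂(sphMeas n) := by
  have hn0 : 0 < n := by omega
  induction p using Polynomial.induction_on' with
  | add p q hp hq =>
    simp only [Polynomial.eval_add, add_mul]
    rw [intervalIntegral.integral_add (Continuous.intervalIntegrable (by fun_prop) _ _)
      (Continuous.intervalIntegrable (by fun_prop) _ _), hp, hq,
      sph_integral_add hn0 (f := fun z => p.eval (inner ℝ z l)) (g := fun z => q.eval (inner ℝ z l))
      (by fun_prop) (by fun_prop)]
    ring
  | monomial k a =>
    simp only [Polynomial.eval_monomial]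
    rw [integral_const_mul]
    change _ = cMom (n-2) 0 * (a * sMom l k)
    simp only [mul_assoc]
    rw [intervalIntegral.integral_const_mul]
    change a * cMom (n-2) k = _
    rw [cMom_sMom hn hl]; ring

lemma density (hn : 2 ≤ n) {l : EuclideanSpace ℝ (Fin n)} (hl : ‖l‖ = 1) {g : ℝ → ℝ}
    (hg : ContinuousOn g (Icc (-1) 1)) :
    ∫ θ in (0:ℝ)..Real.pi, g (Real.cos θ) * (Real.sin θ)^(n-2) =
      cMom (n-2) 0 * ∫ z, g (inner ℝ z l) ∂(sphMeas n) := by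
  have hn0 : 0 < n := by omega
  set I := cMom (n-2) 0 with hI
  have hI0 : 0 < I := cMom_zero_pos _
  have hpi := Real.pi_pos
  have hzl : ∀ z ∈ Metric.sphere (0 : EuclideanSpace ℝ (Fin n)) 1, (inner ℝ z l : ℝ) ∈ Icc (-1:ℝ) 1 := by
    intro z hz
    have hz : ‖z‖ = 1 := by simpa using hz
    have := abs_real_inner_le_norm z l
    rw [hz, hl, mul_one] at this
    exact abs_le.1 this
  have hgz : ContinuousOn (fun z : EuclideanSpace ℝ (Fin n) => g (inner ℝ z l)) (Metric.sphere 0 1) :=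
    hg.comp (f := fun z : EuclideanSpace ℝ (Fin n) => (inner ℝ z l : ℝ)) (by fun_prop) hzl
  have hgc : Continuous (fun θ => g (Real.cos θ)) := by
    rw [← continuousOn_univ]
    exact hg.comp Real.continuous_cos.continuousOn (fun θ _ => Real.cos_mem_Icc θ)
  have hgs : Continuous (fun θ => g (Real.cos θ) * (Real.sin θ)^(n-2)) := hgc.mul (by fun_prop)
  refine eq_of_abs_sub_le_all fun ε hε => ?_
  set δ := ε / (2 * I) with hδ
  have hδ0 : 0 < δ := by positivity
  obtain ⟨p, hp⟩ := exists_polynomial_near_of_continuousOn (-1) 1 g hg δ hδ0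
  have e1 : |(∫ θ in (0:ℝ)..Real.pi, g (Real.cos θ) * (Real.sin θ)^(n-2)) -
      ∫ θ in (0:ℝ)..Real.pi, p.eval (Real.cos θ) * (Real.sin θ)^(n-2)| ≤ δ * I := by
    rw [← intervalIntegral.integral_sub (Continuous.intervalIntegrable hgs _ _)
      (Continuous.intervalIntegrable (by fun_prop) _ _)]
    have : δ * I = ∫ θ in (0:ℝ)..Real.pi, δ * (Real.sin θ)^(n-2) := by
      rw [intervalIntegral.integral_const_mul, hI]; unfold cMom; simp
    rw [this]
    refine (intervalIntegral.abs_integral_le_integral_abs hpi.le).trans ?_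
    refine intervalIntegral.integral_mono_on hpi.le
      (Continuous.intervalIntegrable (hgs.sub (by fun_prop)).abs _ _)
      (Continuous.intervalIntegrable (by fun_prop) _ _) ?_
    intro θ hθ
    have hs : 0 ≤ Real.sin θ ^ (n-2) := pow_nonneg (Real.sin_nonneg_of_nonneg_of_le_pi hθ.1 hθ.2) _
    rw [← sub_mul, abs_mul, abs_of_nonneg hs, abs_sub_comm]
    exact mul_le_mul_of_nonneg_right (hp _ (Real.cos_mem_Icc θ)).le hs
  have e2 : |(∫ z, p.eval (inner ℝ z l) ∂(sphMeas n)) - ∫ z, g (inner ℝ z l) ∂(sphMeas n)| ≤ δ := by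
    rw [← sph_integral_sub hn0 (f := fun z => p.eval (inner ℝ z l)) (g := fun z => g (inner ℝ z l))
      (by fun_prop) hgz]
    refine abs_integral_le_integral_abs.trans ?_
    refine (sph_integral_mono hn0 (g := fun _ => δ) ?_ continuousOn_const ?_).trans ?_
    · exact ContinuousOn.abs (ContinuousOn.sub (by fun_prop) hgz)
    · intro z hz
      exact (hp _ (hzl z hz)).le
    · simp
  rw [density_poly hn hl] at e1
  have e3 : I * |(∫ z, p.eval (inner ℝ z l) ∂(sphMeas n)) - ∫ z, g (inner ℝ z l) ∂(sphMeas n)| ≤ I * δ := by gcongr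
  rw [← abs_of_pos hI0, ← abs_mul, abs_of_pos hI0, mul_sub] at e3
  have e4 : ε = δ * I + I * δ := by rw [hδ]; field_simp; norm_num
  rw [e4]
  exact (abs_sub_le _ _ _).trans (add_le_add e1 e3)
end

end

section

theorem poly_l1 (s t : ℝ) (hs : 0 ≤ s) (hs1 : s ≤ 1) (ht : 0 ≤ t) (ht1 : t ≤ 1) :
    0 ≤ 3*t*((1+(s*(1-s^2)/2 - s^3*(1-s)/8)*t - 17/50*s^2*(1-s)*t^2)*((1-s/2*(s*(3-s^2)/2))+((s*(3-s^2)/2)-s/2)*t)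
      -(1+(s*(3-s^2)/2)*t)*(1-(s/2)^2)^2*(1-(s/2)^2/2))
      +(1-t^2)*((s*(1-s^2)/2)*(1+(s*(1-s^2)/2 - s^3*(1-s)/8)*t - 17/50*s^2*(1-s)*t^2)
        -(1-s/2*t)*(1+(s*(3-s^2)/2)*t)*((s*(1-s^2)/2 - s^3*(1-s)/8) - 2*(17/50*s^2*(1-s))*t)) := by
  rcases hs.eq_or_lt with rfl | hs
  · ring_nf; positivity
  rcases ht.eq_or_lt with rfl | ht
  · have : 0 ≤ s^3*(1-s) := mul_nonneg (by positivity) (by linarith)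
    nlinarith
  obtain ⟨q, hq, rfl⟩ : ∃ q : ℝ, 0 ≤ q ∧ s = 1/(1+q) := ⟨1/s-1, by rw [sub_nonneg, le_div_iff₀ hs]; linarith, by field_simp; ring⟩
  obtain ⟨r, hr, rfl⟩ : ∃ r : ℝ, 0 ≤ r ∧ t = 1/(1+r) := ⟨1/t-1, by rw [sub_nonneg, le_div_iff₀ ht]; linarith, by field_simp; ring⟩
  field_simp
  ring_nf
  positivity

end

section

set_option maxRecDepth 100000 in
set_option maxHeartbeats 4000000 in
theorem poly_l2 (m s t : ℝ) (hm : 0 < m) (hm1 : m ≤ 2/5) (hs : 0 ≤ s) (hs1 : s ≤ 1) (ht : 0 ≤ t) (ht1 : t ≤ 1)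
    (c K g C E al b : ℝ) (hc : c = (1-m)*s) (hK : K = 1-s^2*(1-2*m)) (hg : g = s*(1+m-(1-m)*s^2))
    (hC : C = 1-c^2) (hE : E = 1-(1-m)*(1-2*m)*s^2) (hal : al = (1-m)*s*(1-s^2)) (hb : b = -(3/10)*s^2*(1-s^2)) :
    0 ≤ (2-m)*t*(E*(K+al*t+b*t^2)*(K-c*g+(g-c*K)*t)-K*(K+g*t)*C^2*(1-c^2/2))
      +m*E*(1-t^2)*(al*(K+al*t+b*t^2)-(1-c*t)*(K+g*t)*(al+2*b*t)) := by
  subst hb hal hE hC hg hK hc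
  rcases hs.eq_or_lt with rfl | hs
  · ring_nf; positivity
  rcases ht.eq_or_lt with rfl | ht
  · ring_nf; positivity
  obtain ⟨p, hp, rfl⟩ : ∃ q : ℝ, 0 ≤ q ∧ m = 2/(5*(1+q)) := ⟨2/5/m-1, by rw [sub_nonneg, le_div_iff₀ hm]; linarith, by field_simp; ring⟩
  obtain ⟨q, hq, rfl⟩ : ∃ q : ℝ, 0 ≤ q ∧ s = 1/(1+q) := ⟨1/s-1, by rw [sub_nonneg, le_div_iff₀ hs]; linarith, by field_simp; ring⟩
  obtain ⟨r, hr, rfl⟩ : ∃ r : ℝ, 0 ≤ r ∧ t = 1/(1+r) := ⟨1/t-1, by rw [sub_nonneg, le_div_iff₀ ht]; linarith, by field_simp; ring⟩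
  field_simp
  ring_nf
  positivity

end

section
open MeasureTheory Filter Topology Set

section

noncomputable def polyH (m s c K g C E al b t : ℝ) : ℝ :=
  (2-m)*t*(E*(K+al*t+b*t^2)*(K-c*g+(g-c*K)*t)-K*(K+g*t)*C^2*(1-c^2/2))
      +m*E*(1-t^2)*((1-m)*s*(1-s^2)*(K+al*t+b*t^2)-(1-c*t)*(K+g*t)*(al+2*b*t))

lemma polyH_exists (m s : ℝ) (hm : (0 < m ∧ m ≤ 2/5) ∨ m = 1/2) (hs : 0 ≤ s) (hs1 : s ≤ 1)
    (c K g C E : ℝ) (hc : c = (1-m)*s) (hK : K = 1-s^2*(1-2*m)) (hg : g = s*(1+m-(1-m)*s^2))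
    (hC : C = 1-c^2) (hE : E = 1-(1-m)*(1-2*m)*s^2) :
    ∃ al b : ℝ, ∀ t, 0 ≤ t → t ≤ 1 → 0 ≤ polyH m s c K g C E al b t := by
  rcases hm with ⟨h0, h1⟩ | rfl
  · refine ⟨(1-m)*s*(1-s^2), -(3/10)*s^2*(1-s^2), fun t ht ht1 => ?_⟩
    have := poly_l2 m s t h0 h1 hs hs1 ht ht1 c K g C E _ _ hc hK hg hC hE rfl rfl
    exact this
  · refine ⟨s*(1-s^2)/2 - s^3*(1-s)/8, -(17/50*s^2*(1-s)), fun t ht ht1 => ?_⟩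
    have := poly_l1 s t hs hs1 ht ht1
    unfold polyH
    subst hE hC hg hK hc
    have h2 := mul_nonneg (show (0:ℝ) ≤ 1/2 by norm_num) this
    refine h2.trans_eq ?_
    ring

lemma key_alg (m s c K g C E al b N la d τ t : ℝ) (hm : 0 < m) (hm1 : m < 1)
    (hc : c = (1-m)*s) (hK : K = 1-s^2*(1-2*m)) (hg : g = s*(1+m-(1-m)*s^2))
    (hC : C = 1-c^2) (hN : N = (2-m)/m) (hla : la = (1-m)/m)
    (hK0 : 0 < K) (hC0 : 0 < C) (hp0 : 0 < 1-c*τ) (hcc : 0 < 1-c^2/2)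
    (hd : d = E/(K*(C^2*(1-c^2/2))))
    (ht : t = (c-τ)/(1-c*τ))
    (hpoly : 0 ≤ polyH m s c K g C E al b τ) :
    (c-t)*(1+s^2-2*s*t) ≤ -(C/N)*((d*(al+2*b*τ))*(C/(1-c*t)^2)*(1-t^2)*(1+s^2-2*s*t)
      + N*(d*(K+al*τ+b*τ^2))*t*(1+s^2-2*s*t) - 2*la*s*(d*(K+al*τ+b*τ^2))*(1-t^2)) := by
  obtain ⟨p, hp⟩ : ∃ p, p = 1-c*τ := ⟨_, rfl⟩
  obtain ⟨Q, hQ⟩ : ∃ Q, Q = K+g*τ := ⟨_, rfl⟩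
  rw [← hp] at hp0 ht
  have hN0 : 0 < N := by rw [hN]; exact div_pos (by linarith) hm
  have e1 : 1+s^2-2*s*t = Q/p := by
    rw [ht]; field_simp; rw [hQ, hp, hg, hK, hc]; ring
  have e2 : 1-c*t = C/p := by rw [ht]; field_simp; rw [hp, hC]; ring
  have e3 : 1-t^2 = (1-τ^2)*C/p^2 := by rw [ht]; field_simp; rw [hp, hC]; ring
  have e4 : c-t = τ*C/p := by rw [ht]; field_simp; rw [hp, hC]; ring
  have e5 : N*(τ-c)*Q+2*la*s*C*(1-τ^2) = N*τ*(K-c*g+(g-c*K)*τ)+(1-τ^2)*((1-m)*s*(1-s^2)) := by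
    rw [hN, hla, hQ]; field_simp; rw [hC, hg, hK, hc]; ring
  obtain ⟨D, hD⟩ : ∃ D, D = d*(K+al*τ+b*τ^2) := ⟨_, rfl⟩
  obtain ⟨Dp, hDp⟩ : ∃ D, D = d*(al+2*b*τ) := ⟨_, rfl⟩
  rw [← hD, ← hDp, e1, e2, e3, e4, ht, ← sub_nonneg]
  have hH : D*(N*(τ-c)*Q+2*la*s*C*(1-τ^2)) - (1-τ^2)*p*Q*Dp - N*τ*Q
      = polyH m s c K g C E al b τ/(m*(K*(C^2*(1-c^2/2)))) := by
    rw [e5, hD, hDp, hd, hN, hQ, hp, polyH]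
    have : (1-c^2/2) ≠ 0 := hcc.ne'
    generalize 1-c^2/2 = W at *
    field_simp
    ring
  have hH0 : 0 ≤ D*(N*(τ-c)*Q+2*la*s*C*(1-τ^2)) - (1-τ^2)*p*Q*Dp - N*τ*Q := by
    rw [hH]; positivity
  have : 0 ≤ C/(N*p^2)*(D*(N*(τ-c)*Q+2*la*s*C*(1-τ^2)) - (1-τ^2)*p*Q*Dp - N*τ*Q) := by positivity
  refine this.trans_eq ?_
  field_simp
  ring
end

end

section
open MeasureTheory Filter Topology Set

section

lemma bdry_bound (k : ℕ) (hk : 2 ≤ k) (m s c K C E : ℝ) (hm : m = 2/((k:ℝ)+2)) (hs : 0 ≤ s) (hs1 : s < 1)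
    (hc : c = (1-m)*s) (hK : K = 1-s^2*(1-2*m))
    (hC : C = 1-c^2) (hE : E = 1-(1-m)*(1-2*m)*s^2) (hC0 : 0 < C) (hcc : 0 < 1-c^2/2) :
    C*(E/(C^2*(1-c^2/2)))*(√C)^(k+1)*K^(-((k:ℝ)/2)) ≤ 1 := by
  have hk' : (2:ℝ) ≤ k := by exact_mod_cast hk
  have hm0 : 0 < m := by rw [hm]; positivity
  have hm1 : m ≤ 1/2 := by rw [hm, div_le_div_iff₀ (by positivity) (by norm_num)]; linarith
  have hlm : (k:ℝ)/2*m = 1-m := by rw [hm]; field_simp; ring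
  have hKC : K = C + m^2*s^2 := by rw [hK, hC, hc]; ring
  have hK0 : 0 < K := by rw [hKC]; positivity
  have hEC : E = C + (1-m)*m*s^2 := by rw [hE, hC, hc]; ring
  have hE0 : 0 < E := by
    rw [hEC]; have : 0 ≤ (1-m)*m*s^2 := mul_nonneg (mul_nonneg (by linarith) hm0.le) (by positivity)
    linarith
  have hb : E/C ≤ (K/C)^((k:ℝ)/2) := by
    have := one_add_mul_self_le_rpow_one_add (s := m^2*s^2/C) (by
      have : 0 ≤ m^2*s^2/C := by positivity
      linarith) (p := (k:ℝ)/2) (by linarith)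
    convert this using 1
    · rw [hEC, ← hlm]; field_simp
    · rw [hKC]; congr 1; field_simp
  rw [Real.div_rpow hK0.le hC0.le, div_le_div_iff₀ hC0 (by positivity)] at hb
  have hsq : (√C)^(k+1) = √C * C^((k:ℝ)/2) := by
    rw [pow_succ, mul_comm, Real.sqrt_eq_rpow, ← Real.rpow_natCast, ← Real.rpow_mul hC0.le]
    congr 2; ring
  rw [hsq, Real.rpow_neg hK0.le]
  have hsc : √C ≤ 1-c^2/2 := by
    rw [Real.sqrt_le_left hcc.le, hC]; nlinarith [sq_nonneg (c^2)]
  have hKl : 0 < K^((k:ℝ)/2) := by positivity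
  have : C*(E/(C^2*(1-c^2/2)))*(√C * C^((k:ℝ)/2))*(K^((k:ℝ)/2))⁻¹
     = (√C/(1-c^2/2)) * ((E * C^((k:ℝ)/2))/(K^((k:ℝ)/2)*C)) := by
    generalize 1-c^2/2 = W at *
    field_simp
  rw [this]
  have h1 : √C/(1-c^2/2) ≤ 1 := by rw [div_le_one hcc]; exact hsc
  have h2 : (E * C^((k:ℝ)/2))/(K^((k:ℝ)/2)*C) ≤ 1 := by rw [div_le_one (by positivity)]; exact hb
  exact mul_le_one₀ h1 (by positivity) h2

set_option maxHeartbeats 1000000 in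
lemma oneD (k : ℕ) (hk : 2 ≤ k) (s : ℝ) (hs : 0 ≤ s) (hs1 : s < 1) :
    ∫ θ in (0:ℝ)..Real.pi, (max ((k:ℝ)/((k:ℝ)+2)*s - Real.cos θ) 0 *
      (1+s^2-2*s*Real.cos θ)^(-((k:ℝ)/2))) * (Real.sin θ)^k ≤ 1/((k:ℝ)+1) := by
  have hk' : (2:ℝ) ≤ k := by exact_mod_cast hk
  obtain ⟨m, hm⟩ : ∃ m, m = 2/((k:ℝ)+2) := ⟨_, rfl⟩
  obtain ⟨c, hc⟩ : ∃ c, c = (1-m)*s := ⟨_, rfl⟩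
  obtain ⟨K, hK⟩ : ∃ K, K = 1-s^2*(1-2*m) := ⟨_, rfl⟩
  obtain ⟨g, hg⟩ : ∃ g, g = s*(1+m-(1-m)*s^2) := ⟨_, rfl⟩
  obtain ⟨C, hC⟩ : ∃ C, C = 1-c^2 := ⟨_, rfl⟩
  obtain ⟨E, hE⟩ : ∃ E, E = 1-(1-m)*(1-2*m)*s^2 := ⟨_, rfl⟩
  have hm0 : 0 < m := by rw [hm]; positivity
  have hm1 : m ≤ 1/2 := by rw [hm, div_le_div_iff₀ (by positivity) (by norm_num)]; linarith
  have hc0 : 0 ≤ c := by rw [hc]; exact mul_nonneg (by linarith) hs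
  have hc1 : c < 1 := by rw [hc]; nlinarith
  have hC0 : 0 < C := by rw [hC]; nlinarith
  have hcc : 0 < 1-c^2/2 := by nlinarith
  have hKC : K = C + m^2*s^2 := by rw [hK, hC, hc]; ring
  have hK0 : 0 < K := by rw [hKC]; positivity
  have hck : (k:ℝ)/((k:ℝ)+2)*s = c := by rw [hc, hm]; field_simp; ring
  have hmc : (0 < m ∧ m ≤ 2/5) ∨ m = 1/2 := by
    rcases hk.eq_or_lt with rfl | h
    · right; rw [hm]; norm_num
    · left; refine ⟨hm0, ?_⟩
      have : (3:ℝ) ≤ k := by exact_mod_cast h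
      rw [hm, div_le_div_iff₀ (by positivity) (by norm_num)]; linarith
  obtain ⟨al, b, hpoly⟩ := polyH_exists m s hmc hs hs1.le c K g C E hc hK hg hC hE
  obtain ⟨d, hd⟩ : ∃ d, d = E/(K*(C^2*(1-c^2/2))) := ⟨_, rfl⟩
  rw [hck]
  have hq : ∀ θ : ℝ, 0 < 1+s^2-2*s*Real.cos θ := fun θ => by
    nlinarith [Real.cos_le_one θ, mul_nonneg hs (sub_nonneg.2 (Real.cos_le_one θ)), sq_pos_of_pos (sub_pos.2 hs1)]
  have hr : ∀ θ : ℝ, 0 < 1-c*Real.cos θ := fun θ => by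
    nlinarith [mul_nonneg hc0 (sub_nonneg.2 (Real.cos_le_one θ))]
  have hcontq : Continuous fun θ : ℝ => (1+s^2-2*s*Real.cos θ)^(-((k:ℝ)/2)) :=
    Continuous.rpow_const (by fun_prop) (fun θ => Or.inl (hq θ).ne')
  set F : ℝ → ℝ := fun θ => (max (c - Real.cos θ) 0 *
      (1+s^2-2*s*Real.cos θ)^(-((k:ℝ)/2))) * (Real.sin θ)^k with hF
  have hFc : Continuous F := by
    apply Continuous.mul (Continuous.mul (by fun_prop) hcontq) (by fun_prop)
  have hac0 : 0 ≤ Real.arccos c := Real.arccos_nonneg c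
  have hacp : Real.arccos c ≤ Real.pi := Real.arccos_le_pi c
  have hcac : Real.cos (Real.arccos c) = c := Real.cos_arccos (by linarith) hc1.le
  have hsac : Real.sin (Real.arccos c) = √C := by rw [Real.sin_arccos, hC]
  rw [← intervalIntegral.integral_add_adjacent_intervals (hFc.intervalIntegrable 0 (Real.arccos c))
    (hFc.intervalIntegrable _ _)]
  have hz : ∫ θ in (0:ℝ)..(Real.arccos c), F θ = 0 := by
    rw [intervalIntegral.integral_congr (g := fun _ => (0:ℝ))]
    · simp
    · intro θ hθ
      rw [uIcc_of_le hac0] at hθ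
      have : c ≤ Real.cos θ := by
        rw [← hcac]; exact Real.cos_le_cos_of_nonneg_of_le_pi hθ.1 hacp hθ.2
      simp only [hF]
      rw [max_eq_right (by linarith)]; simp
  rw [hz, zero_add]
  set τ : ℝ → ℝ := fun θ => (c - Real.cos θ)/(1-c*Real.cos θ) with hτ
  set Φ : ℝ → ℝ := fun θ => -(C/((k:ℝ)+1))*((d*(K+al*τ θ+b*(τ θ)^2))*((Real.sin θ)^(k+1)*
    (1+s^2-2*s*Real.cos θ)^(-((k:ℝ)/2)))) with hΦ
  set Φ' : ℝ → ℝ := fun θ => (Real.sin θ)^k*(1+s^2-2*s*Real.cos θ)^(-((k:ℝ)/2)-1)*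
    (-(C/((k:ℝ)+1))*((d*(al+2*b*τ θ))*(C/(1-c*Real.cos θ)^2)*(1-(Real.cos θ)^2)*(1+s^2-2*s*Real.cos θ)
      + ((k:ℝ)+1)*(d*(K+al*τ θ+b*(τ θ)^2))*Real.cos θ*(1+s^2-2*s*Real.cos θ)
      - 2*((k:ℝ)/2)*s*(d*(K+al*τ θ+b*(τ θ)^2))*(1-(Real.cos θ)^2))) with hΦ'
  have hder : ∀ θ, HasDerivAt Φ (Φ' θ) θ := by
    intro θ
    have h1 : HasDerivAt τ (C*Real.sin θ/(1-c*Real.cos θ)^2) θ := by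
      have := ((Real.hasDerivAt_cos θ).const_sub c).div (((Real.hasDerivAt_cos θ).const_mul c).const_sub 1) (hr θ).ne'
      refine this.congr_deriv ?_
      rw [hC]; congr 1; ring
    have h2 : HasDerivAt (fun θ => d*(K+al*τ θ+b*(τ θ)^2)) (d*(al+2*b*τ θ)*(C*Real.sin θ/(1-c*Real.cos θ)^2)) θ := by
      have := (((h1.const_mul al).const_add K).add ((h1.pow 2).const_mul b)).const_mul d
      refine this.congr_deriv ?_
      simp only [Nat.cast_ofNat]; ring
    have h3 := (Real.hasDerivAt_sin θ).pow (k+1)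
    have h4 := (((Real.hasDerivAt_cos θ).const_mul (2*s)).const_sub (1+s^2)).rpow_const
      (p := -((k:ℝ)/2)) (Or.inl (hq θ).ne')
    have := (h2.mul (h3.mul h4)).const_mul (-(C/((k:ℝ)+1)))
    refine this.congr_deriv ?_
    have hqq : (1+s^2-2*s*Real.cos θ)^(-((k:ℝ)/2)) = (1+s^2-2*s*Real.cos θ)^(-((k:ℝ)/2)-1)*(1+s^2-2*s*Real.cos θ) := by
      rw [← Real.rpow_add_one (hq θ).ne']; congr 1; ring
    simp only [hΦ', Pi.mul_apply, Pi.pow_apply]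
    rw [hqq]
    generalize (1+s^2-2*s*Real.cos θ)^(-((k:ℝ)/2)-1) = G
    rw [← Real.sin_sq θ]
    push_cast
    ring
  have hmain := intervalIntegral.integral_le_sub_of_hasDeriv_right_of_le hacp
    (fun θ _ => (hder θ).continuousAt.continuousWithinAt)
    (fun θ _ => (hder θ).hasDerivWithinAt) (hFc.integrableOn_Icc) (fun θ hθ => by
      have hθ0 : 0 ≤ θ := hac0.trans hθ.1.le
      have hsin : 0 ≤ Real.sin θ := Real.sin_nonneg_of_nonneg_of_le_pi hθ0 hθ.2.le
      have hcos : Real.cos θ ≤ c := by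
        rw [← hcac]; exact Real.cos_le_cos_of_nonneg_of_le_pi hac0 hθ.2.le hθ.1.le
      have hcos1 : -1 ≤ Real.cos θ := Real.neg_one_le_cos θ
      have hτ0 : 0 ≤ τ θ := div_nonneg (by linarith) (hr θ).le
      have hτ1 : τ θ ≤ 1 := by
        simp only [hτ]; rw [div_le_one (hr θ)]
        nlinarith
      have hp0 : 0 < 1 - c*τ θ := by nlinarith
      have hpe : 1 - c*τ θ = C/(1-c*Real.cos θ) := by
        have := (hr θ).ne'
        simp only [hτ]; rw [hC]; field_simp; ring
      have ht : Real.cos θ = (c-τ θ)/(1-c*τ θ) := by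
        have h0 : τ θ * (1-c*Real.cos θ) = c - Real.cos θ := div_mul_cancel₀ _ (hr θ).ne'
        rw [eq_div_iff hp0.ne']; linarith
      have hkey := key_alg m s c K g C E al b ((k:ℝ)+1) ((k:ℝ)/2) d (τ θ) (Real.cos θ) hm0 (by linarith)
        hc hK hg hC (by rw [hm]; field_simp; ring) (by rw [hm]; field_simp; ring) hK0 hC0 hp0 hcc hd ht
        (hpoly _ hτ0 hτ1)
      have hqq : (1+s^2-2*s*Real.cos θ)^(-((k:ℝ)/2)) = (1+s^2-2*s*Real.cos θ)^(-((k:ℝ)/2)-1)*(1+s^2-2*s*Real.cos θ) := by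
        rw [← Real.rpow_add_one (hq θ).ne']; congr 1; ring
      have hG : 0 ≤ (Real.sin θ)^k*(1+s^2-2*s*Real.cos θ)^(-((k:ℝ)/2)-1) :=
        mul_nonneg (by positivity) (Real.rpow_nonneg (hq θ).le _)
      have := mul_le_mul_of_nonneg_left hkey hG
      simp only [hF, hΦ']
      rw [max_eq_left (by linarith), hqq]
      refine le_trans (le_of_eq ?_) this
      ring)
  refine hmain.trans ?_
  have hB := bdry_bound k hk m s c K C E hm hs hs1 hc hK hC hE hC0 hcc
  have e1 : Φ Real.pi = 0 := by simp [hΦ]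
  have e2 : τ (Real.arccos c) = 0 := by simp [hτ, hcac]
  have e3 : Φ (Real.arccos c) = -(1/((k:ℝ)+1)) * (C*(E/(C^2*(1-c^2/2)))*(√C)^(k+1)*K^(-((k:ℝ)/2))) := by
    simp only [hΦ]
    rw [e2, hsac, hcac, show 1+s^2-2*s*c = K by rw [hK, hc]; ring, hd]
    generalize 1-c^2/2 = W at *
    field_simp
    ring
  rw [e1, e3]
  have hk1 : 0 < 1/((k:ℝ)+1) := by positivity
  nlinarith
end

end

section
open MeasureTheory Filter Topology Set

section
variable {n : ℕ}

lemma cMom_gamma (n : ℕ) : cMom n 0 * Real.Gamma ((n:ℝ)/2+1) = √Real.pi * Real.Gamma (((n:ℝ)+1)/2) := by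
  have hI : ∀ n, cMom n 0 = ∫ θ in (0:ℝ)..Real.pi, (Real.sin θ)^n := fun n => by simp [cMom]
  have hpi : √Real.pi * √Real.pi = Real.pi := Real.mul_self_sqrt Real.pi_pos.le
  induction n using Nat.strong_induction_on with
  | _ n ih =>
    match n with
    | 0 =>
      rw [hI]; simp
      rw [show (2:ℝ)⁻¹ = 1/2 by norm_num, Real.Gamma_one_half_eq, hpi]
    | 1 =>
      rw [hI]; simp
      rw [Real.Gamma_add_one (by norm_num), show (2:ℝ)⁻¹ = 1/2 by norm_num, Real.Gamma_one_half_eq]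
      ring
    | n+2 =>
      have h := ih n (by omega)
      rw [hI] at h
      rw [hI, integral_sin_pow]
      have e1 : Real.Gamma (((n+2:ℕ):ℝ)/2+1) = ((n:ℝ)/2+1)*Real.Gamma ((n:ℝ)/2+1) := by
        rw [← Real.Gamma_add_one (by positivity)]; congr 1; push_cast; ring
      have e2 : Real.Gamma ((((n+2:ℕ):ℝ)+1)/2) = (((n:ℝ)+1)/2)*Real.Gamma (((n:ℝ)+1)/2) := by
        rw [← Real.Gamma_add_one (by positivity)]; congr 1; push_cast; ring
      rw [e1, e2]
      simp only [Real.sin_zero, Real.sin_pi, ne_eq, Nat.add_eq_zero_iff, one_ne_zero, and_false, not_false_eq_true, zero_pow, zero_mul, sub_self, zero_div, zero_add]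
      generalize Real.Gamma ((n:ℝ)/2+1) = A at *
      generalize Real.Gamma (((n:ℝ)+1)/2) = B at *
      generalize (∫ x in (0:ℝ)..Real.pi, Real.sin x^n) = J at *
      field_simp
      linear_combination h

lemma unitBallVol_eq (k : ℕ) (hk : 0 < k) : unitBallVol k = √Real.pi^k/Real.Gamma ((k:ℝ)/2+1) := by
  haveI : Nonempty (Fin k) := ⟨⟨0, hk⟩⟩
  rw [unitBallVol, EuclideanSpace.volume_ball]
  have : 0 < Real.Gamma ((k:ℝ)/2+1) := Real.Gamma_pos_of_pos (by positivity)
  simp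
  positivity

lemma ball_ratio (hn : 2 ≤ n) : unitBallVol (n-1) / unitBallVol n = 1 / cMom n 0 := by
  obtain ⟨k, rfl⟩ : ∃ k, n = k+1 := ⟨n-1, by omega⟩
  have h := cMom_gamma (k+1)
  rw [unitBallVol_eq _ (by omega), unitBallVol_eq _ (by omega)]
  simp only [Nat.add_sub_cancel]
  have g1 : 0 < Real.Gamma (((k+1:ℕ):ℝ)/2+1) := Real.Gamma_pos_of_pos (by positivity)
  have g2 : 0 < Real.Gamma ((k:ℝ)/2+1) := Real.Gamma_pos_of_pos (by positivity)
  have hc := cMom_zero_pos (k+1)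
  rw [show (((k+1:ℕ):ℝ)+1)/2 = (k:ℝ)/2+1 by push_cast; ring] at h
  have hp : 0 < √Real.pi := Real.sqrt_pos.2 Real.pi_pos
  rw [pow_succ]
  generalize Real.Gamma ((k:ℝ)/2+1) = A at *
  generalize Real.Gamma (((k+1:ℕ):ℝ)/2+1) = B at *
  field_simp
  linarith

lemma oneD_zero : ∫ θ in (0:ℝ)..Real.pi, max (- Real.cos θ) 0 = 1 := by
  have hc : Continuous fun θ : ℝ => max (- Real.cos θ) 0 := by fun_prop
  have hp := Real.pi_pos
  rw [← intervalIntegral.integral_add_adjacent_intervals (hc.intervalIntegrable 0 (Real.pi/2))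
    (hc.intervalIntegrable _ _)]
  have h1 : ∫ θ in (0:ℝ)..(Real.pi/2), max (- Real.cos θ) 0 = ∫ θ in (0:ℝ)..(Real.pi/2), (0:ℝ) := by
    apply intervalIntegral.integral_congr
    intro θ hθ
    rw [uIcc_of_le (by positivity)] at hθ
    have := Real.cos_nonneg_of_neg_pi_div_two_le_of_le (by linarith [hθ.1]) hθ.2
    exact max_eq_right (by linarith)
  have h2 : ∫ θ in (Real.pi/2)..Real.pi, max (- Real.cos θ) 0 = ∫ θ in (Real.pi/2)..Real.pi, (-Real.cos θ) := by
    apply intervalIntegral.integral_congr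
    intro θ hθ
    rw [uIcc_of_le (by linarith)] at hθ
    have := Real.cos_nonpos_of_pi_div_two_le_of_le hθ.1 (by linarith [hθ.2])
    exact max_eq_left (by linarith)
  rw [h1, h2]
  simp

lemma newt_axis {l z : EuclideanSpace ℝ (Fin n)} (hl : ‖l‖ = 1) (hz : ‖z‖ = 1) (s : ℝ) :
    newt (s • l) z = (1+s^2-2*s*inner ℝ z l)^(-(((n:ℝ)-2)/2)) := by
  have : ‖s • l - z‖^2 = 1+s^2-2*s*inner ℝ z l := by
    rw [norm_sub_sq_real, norm_smul, hl, hz, inner_smul_left, real_inner_comm]; simp; ring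
  rw [newt, genKer, this]; simp

lemma const_bound (hn : n = 2 ∨ 4 ≤ n) {a l : EuclideanSpace ℝ (Fin n)} (ha : ‖a‖ < 1) (hl : ‖l‖ = 1)
    (hal : 0 ≤ (inner ℝ a l : ℝ)) :
    2 * n * ∫ η, max (((n:ℝ)-2)/n * inner ℝ a l - inner ℝ η l) 0 * newt a η ∂(sphMeas n) ≤
      2 * unitBallVol (n-1) / unitBallVol n := by
  have hn2 : 2 ≤ n := by omega
  have hI := cMom_zero_pos (n-2)
  have hIn := cMom_zero_pos n
  have hrec : (n:ℝ) * cMom n 0 = ((n:ℝ)-1)*cMom (n-2) 0 := by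
    obtain ⟨k, rfl⟩ : ∃ k, n = k+2 := ⟨n-2, by omega⟩
    have hI : ∀ n, cMom n 0 = ∫ θ in (0:ℝ)..Real.pi, (Real.sin θ)^n := fun n => by simp [cMom]
    rw [hI, hI, Nat.add_sub_cancel, integral_sin_pow]
    simp
    field_simp
    ring
  have hnr : (2:ℝ) ≤ n := by exact_mod_cast hn2
  suffices h : cMom (n-2) 0 * ∫ η, max (((n:ℝ)-2)/n * inner ℝ a l - inner ℝ η l) 0 * newt a η ∂(sphMeas n) ≤ 1/((n:ℝ)-1) by
    rw [mul_div_assoc, ball_ratio hn2, mul_assoc]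
    apply mul_le_mul_of_nonneg_left _ (by norm_num : (0:ℝ) ≤ 2)
    rw [le_div_iff₀ hIn]
    rw [le_div_iff₀ (by linarith)] at h
    calc _ = (∫ η, max (((n:ℝ)-2)/n * inner ℝ a l - inner ℝ η l) 0 * newt a η ∂(sphMeas n)) * ((n:ℝ) * cMom n 0) := by ring
      _ = _ := by rw [hrec]
      _ ≤ 1 := by linarith
  rcases hn with rfl | hn
  · have e : ∫ η, max ((((2:ℕ):ℝ)-2)/((2:ℕ):ℝ) * inner ℝ a l - inner ℝ η l) 0 * newt a η ∂(sphMeas 2)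
        = ∫ η, (fun t : ℝ => max (-t) 0) (inner ℝ η l) ∂(sphMeas 2) := by
      congr 1; ext η
      simp [newt, genKer]
    rw [e, ← density hn2 hl (g := fun t : ℝ => max (-t) 0) (by fun_prop)]
    simp [oneD_zero]
    norm_num
  · have hs1 : (inner ℝ a l : ℝ) < 1 := by
      have := real_inner_le_norm a l
      rw [hl] at this; linarith
    obtain ⟨s, hs⟩ : ∃ s : ℝ, s = inner ℝ a l := ⟨_, rfl⟩
    have h1 := reduce_axis (by omega) (((n:ℝ)-2)/n * inner ℝ a l) ha hl
    rw [← hs] at h1 hal hs1 ⊢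
    refine (mul_le_mul_of_nonneg_left h1 hI.le).trans ?_
    have e : ∫ η, max (((n:ℝ)-2)/n * s - inner ℝ η l) 0 * newt (s • l) η ∂(sphMeas n)
        = ∫ η, (fun t : ℝ => max (((n:ℝ)-2)/n * s - t) 0 * (1+s^2-2*s*t)^(-(((n:ℝ)-2)/2))) (inner ℝ η l) ∂(sphMeas n) := by
      apply sph_integral_congr (by omega)
      intro z hz
      rw [newt_axis hl (by simpa using hz)]
    rw [e, ← density hn2 hl (g := fun t : ℝ => max (((n:ℝ)-2)/n * s - t) 0 * (1+s^2-2*s*t)^(-(((n:ℝ)-2)/2)))]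
    · obtain ⟨k, rfl⟩ : ∃ k, n = k+2 := ⟨n-2, by omega⟩
      have := oneD k (by omega) s hal hs1
      have e1 : ((k+2:ℕ):ℝ)-2 = k := by push_cast; ring
      have e2 : ((k+2:ℕ):ℝ) = (k:ℝ)+2 := by push_cast; ring
      have e3 : ((k+2:ℕ):ℝ)-1 = (k:ℝ)+1 := by push_cast; ring
      simp only [e1, e3, Nat.add_sub_cancel]
      simp only [e2]
      exact this
    · refine ContinuousOn.mul (by fun_prop) (ContinuousOn.rpow_const (by fun_prop) fun t ht => Or.inl ?_)
      have : 0 < 1+s^2-2*s*t := by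
        nlinarith [mul_nonneg hal (sub_nonneg.2 ht.2), sq_pos_of_pos (sub_pos.2 hs1)]
      exact this.ne'
end

end

section
open MeasureTheory Filter Topology Set

section
variable {n : ℕ}

lemma harm_scale {u : EuclideanSpace ℝ (Fin n) → ℝ} (hu : IsHarmonicOn u (Metric.ball 0 1)) {R : ℝ}
    (hR0 : 0 < R) (hR1 : R < 1) (x : EuclideanSpace ℝ (Fin n)) (hx : ‖x‖ < 1) :
    HarmAt (EuclideanSpace.basisFun (Fin n) ℝ) (fun y => u (R • y)) x := by
  have hball : ∀ y : EuclideanSpace ℝ (Fin n), ‖y‖ < 1 → R • y ∈ Metric.ball (0 : EuclideanSpace ℝ (Fin n)) 1 := by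
    intro y hy
    rw [mem_ball_zero_iff, norm_smul, Real.norm_of_nonneg hR0.le]
    nlinarith [norm_nonneg y]
  have hcd : ∀ y ∈ Metric.ball (0 : EuclideanSpace ℝ (Fin n)) 1, ContDiffAt ℝ 2 u y := fun y hy =>
    hu.1.contDiffAt (Metric.isOpen_ball.mem_nhds hy)
  refine ⟨fun i => R^2 * fderiv ℝ (fun y => fderiv ℝ u y (EuclideanSpace.single i 1)) (R • x)
    (EuclideanSpace.single i 1), ?_, fun i => ?_⟩
  · rw [← Finset.mul_sum, hu.2 _ (hball x hx), mul_zero]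
  · set e : EuclideanSpace ℝ (Fin n) := EuclideanSpace.single i 1 with he
    have hbe : (EuclideanSpace.basisFun (Fin n) ℝ) i = e := by simp [he]
    rw [hbe]
    have hline : ∀ t : ℝ, HasDerivAt (fun t : ℝ => R • (x + t • e)) (R • e) t := by
      intro t
      have := (((hasDerivAt_id t).smul_const e).const_add x).const_smul R
      exact this.congr_deriv (by simp)
    refine ⟨fun t => R * fderiv ℝ u (R • (x + t • e)) e, ?_, ?_⟩
    · have hc : Continuous fun t : ℝ => ‖x + t • e‖ := by fun_prop
      have : ∀ᶠ t in 𝓝 (0:ℝ), ‖x + t • e‖ < 1 := by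
        apply hc.continuousAt.eventually_lt continuousAt_const
        simpa using hx
      filter_upwards [this] with t ht
      have h1 := ((hcd _ (hball _ ht)).differentiableAt (by norm_num)).hasFDerivAt
      have h2 := h1.comp_hasDerivAt t (hline t)
      simpa using! h2
    · have h1 : DifferentiableAt ℝ (fun y => fderiv ℝ u y e) (R • x) := by
        have := ((hcd _ (hball x hx)).fderiv_right (m := 1) (by norm_num)).differentiableAt (by norm_num)
        exact this.clm_apply (differentiableAt_const e)
      have h2 := hline 0
      have h3 : HasFDerivAt (fun y => fderiv ℝ u y e) (fderiv ℝ (fun y => fderiv ℝ u y e) (R • x)) (R • (x + (0:ℝ) • e)) := by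
        simpa using h1.hasFDerivAt
      have h4 := (h3.comp_hasDerivAt 0 h2).const_mul R
      refine h4.congr_deriv ?_
      simp; ring

lemma dir_bound (hn : n = 2 ∨ 4 ≤ n) {u : EuclideanSpace ℝ (Fin n) → ℝ}
    (hu : IsHarmonicOn u (Metric.ball 0 1))
    (hb : ∀ y ∈ Metric.ball (0 : EuclideanSpace ℝ (Fin n)) 1, |u y| < 1)
    {x l : EuclideanSpace ℝ (Fin n)} (hx : ‖x‖ < 1) (hl : ‖l‖ = 1) {R : ℝ} (hxR : ‖x‖ < R) (hR1 : R < 1) :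
    (1 - ‖x‖^2/R^2) * (R * |fderiv ℝ u x l|) ≤ 2 * unitBallVol (n-1) / unitBallVol n := by
  have hR0 : 0 < R := (norm_nonneg x).trans_lt hxR
  wlog hin : 0 ≤ (inner ℝ x l : ℝ) generalizing l with H
  · have := H (l := -l) (by simpa using hl) (by rw [inner_neg_right]; linarith)
    simpa using this
  have hball : ∀ y : EuclideanSpace ℝ (Fin n), ‖y‖ ≤ 1 → R • y ∈ Metric.ball (0 : EuclideanSpace ℝ (Fin n)) 1 := by
    intro y hy
    rw [mem_ball_zero_iff, norm_smul, Real.norm_of_nonneg hR0.le]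
    nlinarith [norm_nonneg y]
  have hna : ‖R⁻¹ • x‖ = ‖x‖/R := by
    rw [norm_smul, norm_inv, Real.norm_of_nonneg hR0.le]; ring
  have ha : ‖R⁻¹ • x‖ < 1 := by rw [hna, div_lt_one hR0]; exact hxR
  have hRx : R • (R⁻¹ • x) = x := smul_inv_smul₀ hR0.ne' x
  have hD : HasFDerivAt (fun y => u (R • y)) ((fderiv ℝ u x).comp (R • ContinuousLinearMap.id ℝ _)) (R⁻¹ • x) := by
    have h1 : HasFDerivAt u (fderiv ℝ u x) (R • (R⁻¹ • x)) := by
      rw [hRx]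
      exact ((hu.1.contDiffAt (Metric.isOpen_ball.mem_nhds (by simpa using hx))).differentiableAt (by norm_num)).hasFDerivAt
    exact h1.comp _ ((hasFDerivAt_id _).const_smul R)
  have hk := kelvin_bound (by omega) (EuclideanSpace.basisFun (Fin n) ℝ) ha hl
    (u := fun y => u (R • y)) (by
      refine hu.1.continuousOn.comp (by fun_prop) fun y hy => hball y (by simpa using hy))
    (fun y hy => harm_scale hu hR0 hR1 y hy) (fun y hy => (hb _ (hball y hy.le)).le) hD
  have hc := const_bound hn ha hl (by rw [inner_smul_left]; exact mul_nonneg (by simpa using hR0.le) hin)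
  have := hk.trans hc
  rw [hna, div_pow] at this
  have e : |((fderiv ℝ u x).comp (R • ContinuousLinearMap.id ℝ _)) l| = R * |fderiv ℝ u x l| := by
    simp [abs_mul, abs_of_pos hR0]
  rwa [e] at this

lemma main_bound (hn : n = 2 ∨ 4 ≤ n)
    (u : EuclideanSpace ℝ (Fin n) → ℝ)
    (hu : IsHarmonicOn u (Metric.ball 0 1))
    (hb : ∀ y ∈ Metric.ball (0 : EuclideanSpace ℝ (Fin n)) 1, |u y| < 1)
    (x : EuclideanSpace ℝ (Fin n)) (hx : x ∈ Metric.ball (0 : EuclideanSpace ℝ (Fin n)) 1) :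
    ‖fderiv ℝ u x‖ ≤ 2 * unitBallVol (n-1) / unitBallVol n * (1 / (1 - ‖x‖^2)) := by
  have hx' : ‖x‖ < 1 := by simpa using hx
  have hpos : 0 < 1 - ‖x‖^2 := by nlinarith [norm_nonneg x]
  have hdir : ∀ l : EuclideanSpace ℝ (Fin n), ‖l‖ = 1 →
      |fderiv ℝ u x l| ≤ 2 * unitBallVol (n-1) / unitBallVol n * (1 / (1 - ‖x‖^2)) := by
    intro l hl
    rw [mul_one_div, le_div_iff₀ hpos]
    have ht : Tendsto (fun R : ℝ => (1 - ‖x‖^2/R^2) * (R * |fderiv ℝ u x l|)) (𝓝[<] 1)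
        (𝓝 ((1 - ‖x‖^2/1^2) * (1 * |fderiv ℝ u x l|))) := by
      apply tendsto_nhdsWithin_of_tendsto_nhds
      have : ContinuousAt (fun R : ℝ => (1 - ‖x‖^2/R^2) * (R * |fderiv ℝ u x l|)) 1 := by
        refine ContinuousAt.mul (ContinuousAt.sub continuousAt_const
          (ContinuousAt.div continuousAt_const (by fun_prop) (by norm_num))) (by fun_prop)
      exact this
    have h := le_of_tendsto ht (b := 2 * unitBallVol (n-1) / unitBallVol n) (by
      filter_upwards [Ioo_mem_nhdsLT hx'] with R hR
      exact dir_bound hn hu hb hx' hl hR.1 hR.2)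
    simp only [one_pow, div_one, one_mul] at h
    linarith
  apply ContinuousLinearMap.opNorm_le_of_unit_norm
  · have h1 : 0 ≤ unitBallVol (n-1) := ENNReal.toReal_nonneg
    have h2 : 0 ≤ unitBallVol n := ENNReal.toReal_nonneg
    positivity
  · intro l hl
    exact hdir l hl
end

end

theorem schwarz_pick_harmonic (n : Nat) (hn : n = 2 ∨ 4 ≤ n)
    (u : EuclideanSpace Real (Fin n) -> Real)
    (hu : IsHarmonicOn u (Metric.ball 0 1))
    (hb : ∀ y ∈ Metric.ball (0 : EuclideanSpace Real (Fin n)) 1, |u y| < 1)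
    (x : EuclideanSpace Real (Fin n)) (hx : x ∈ Metric.ball (0 : EuclideanSpace Real (Fin n)) 1) :
    ‖fderiv Real u x‖ ≤ 2 * unitBallVol (n-1) / unitBallVol n * (1 / (1 - ‖x‖^2)) := by
  exact main_bound hn u hu hb x hx
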